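/- Let (G, {G_(i)}) be a p-filtered group of order p^n with associated polynomials D_i ∈ F_p[Y_1,...,Y_{i-1}], and let K be a local field of characteristic p with perfect residue field. Let u_1 < u_2 < ... < u_n be positive integers with p ∤ u_i, and let a_1,...,a_n ∈ K with v_K(a_i) = −u_i. Define K_0 = K and K_i = K_{i-1}(α_i) for 1 ≤ i ≤ n, where α_i satisfies α_i^p − α_i = d_i + a_i with d_i = D_i(α_1,...,α_{i-1}). Define b_1 < ... < b_n by b_1 = u_1 and b_{i+1} − b_i = p^i(u_{i+1} − u_i). If b_i > −p^{i-1} v_K(d_i) for all i ∉ Σ_G, then: (a) K_n/K is Galois and there is an isomorphism μ : Gal(K_n/K) → G with μ(Gal(K_n/K_i)) = G_(i) for 0 ≤ i ≤ n; (b) K_n/K is totally ramified with upper ramification breaks u_1,...,u_n and lower ramification breaks b_1,...,b_n, and v_K(α_i) = −u_i/p for all i; (c) the ramification subgroups of Gal(K_n/K) are exactly the subgroups Gal(K_n/K_i) for 0 ≤ i ≤ n. -/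

import Mathlib

/-!
STATEMENT 13 (Theorem 4.4 of the paper):
Let (G, {G_(i)}) be a p-filtered group of order p^n with associated Saltman polynomials
D_i, and let K be a local field of characteristic p with perfect residue field.  Let
u_1 < ... < u_n be positive integers prime to p, a_i ∈ K with v_K(a_i) = −u_i, and build
the tower K_i = K_{i-1}(α_i) with α_i^p − α_i = d_i + a_i, d_i = D_i(α_1,...,α_{i-1}).
Define b_1 = u_1, b_{i+1} − b_i = p^i(u_{i+1} − u_i).  If b_i > −p^{i-1} v_K(d_i) for all
i ∉ Σ_G then: (a) K_n/K is Galois with an isomorphism μ : Gal(K_n/K) ≅ G such that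
μ(Gal(K_n/K_i)) = G_(i); (b) K_n/K is totally ramified with upper breaks u_1,...,u_n and
lower breaks b_1,...,b_n, and v_K(α_i) = −u_i/p; (c) the ramification subgroups of
Gal(K_n/K) are exactly the subgroups Gal(K_n/K_i), 0 ≤ i ≤ n.
-/

/-- A normalized discrete valuation on a field `K` (so `v(K×) = ℤ`). -/
structure DVal (K : Type*) [Field K] where
  v : K → ℤ
  v_one : v 1 = 0
  v_mul : ∀ x y : K, x ≠ 0 → y ≠ 0 → v (x * y) = v x + v y
  v_add : ∀ x y : K, x ≠ 0 → y ≠ 0 → x + y ≠ 0 → min (v x) (v y) ≤ v (x + y)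
  exists_uniformizer : ∃ π : K, π ≠ 0 ∧ v π = 1

/-- `K` is complete with respect to the discrete valuation `vK`. -/
def DVal.IsComplete {K : Type*} [Field K] (vK : DVal K) : Prop :=
  ∀ f : ℕ → K,
    (∀ N : ℤ, ∃ M : ℕ, ∀ m n : ℕ, M ≤ m → M ≤ n → f m = f n ∨ N ≤ vK.v (f m - f n)) →
    ∃ a : K, ∀ N : ℤ, ∃ M : ℕ, ∀ m : ℕ, M ≤ m → f m = a ∨ N ≤ vK.v (f m - a)

/-- The residue field of `(K, vK)` is perfect (in characteristic `p` this says the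
Frobenius is surjective on the residue field). -/
def DVal.PerfectResidue {K : Type*} [Field K] (vK : DVal K) (p : ℕ) : Prop :=
  ∀ x : K, (x = 0 ∨ 0 ≤ vK.v x) →
    ∃ y : K, (y = 0 ∨ 0 ≤ vK.v y) ∧ (x - y ^ p = 0 ∨ 1 ≤ vK.v (x - y ^ p))

/-- `σ` belongs to the inertia subgroup: it induces the identity on the residue field. -/
def inInertia (K : Type*) {L : Type*} [Field K] [Field L] [Algebra K L]
    (vL : DVal L) (σ : L ≃ₐ[K] L) : Prop :=
  ∀ x : L, (x = 0 ∨ 0 ≤ vL.v x) → (σ x - x = 0 ∨ 1 ≤ vL.v (σ x - x))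

/-- The ramification number `i(σ) = v_L(σ(π_L) − π_L) − 1` for `σ` in the inertia group,
and `i(σ) = −1` otherwise. -/
noncomputable def ramNum (K : Type*) {L : Type*} [Field K] [Field L] [Algebra K L]
    (vL : DVal L) (πL : L) (σ : L ≃ₐ[K] L) : ℤ := by
  classical exact if inInertia K vL σ then vL.v (σ πL - πL) - 1 else -1

/-- The lower ramification set `G_t = {σ : i(σ) ≥ t}` (together with the identity). -/
def lowerSet (K : Type*) {L : Type*} [Field K] [Field L] [Algebra K L]
    (vL : DVal L) (πL : L) (t : ℝ) : Set (L ≃ₐ[K] L) :=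
  {σ | σ = 1 ∨ (t ≤ (ramNum K vL πL σ : ℝ))}

/-- `b` is a lower ramification break of `L/K`. -/
def IsLowerBreak (K : Type*) {L : Type*} [Field K] [Field L] [Algebra K L]
    (vL : DVal L) (πL : L) (b : ℝ) : Prop :=
  ∃ σ : L ≃ₐ[K] L, σ ≠ 1 ∧ (ramNum K vL πL σ : ℝ) = b

/-- The Hasse–Herbrand function `φ_{L/K}(x) = ∫_0^x dt / (G_0 : G_t)`. -/
noncomputable def hherb (K : Type*) {L : Type*} [Field K] [Field L] [Algebra K L]
    (vL : DVal L) (πL : L) (x : ℝ) : ℝ :=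
  ∫ t in (0:ℝ)..x,
    (Nat.card ↥(lowerSet K vL πL t) : ℝ) / (Nat.card ↥(lowerSet K vL πL 0) : ℝ)

/-- `u` is an upper ramification break of `L/K`:  `ψ_{L/K}(u)` is a lower break. -/
def IsUpperBreak (K : Type*) {L : Type*} [Field K] [Field L] [Algebra K L]
    (vL : DVal L) (πL : L) (u : ℝ) : Prop :=
  ∃ b : ℝ, IsLowerBreak K vL πL b ∧ hherb K vL πL b = u

open MvPolynomial in
/-- `i ∈ Σ_G`: the extension of `G/G_(i-1)` by `G_(i-1)/G_(i)` given by the quotient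
`G/G_(i)` is split. -/
def splitAt {G : Type*} [Group G] (Gser : ℕ → Subgroup G) [∀ j, (Gser j).Normal]
    (i : ℕ) : Prop :=
  ∃ H : Subgroup (G ⧸ Gser i),
    ((Gser (i - 1)).map (QuotientGroup.mk' (Gser i))).IsComplement' H

open MvPolynomial in
/-- The element `X_j = Y_j^p − Y_j − D_j(Y_1,...,Y_{j-1})` of `S_i = F_p[Y_1,...,Y_i]`. -/
noncomputable def Xelt (p : ℕ) (D : (j : ℕ) → MvPolynomial (Fin (j - 1)) (ZMod p))
    (i j : ℕ) (h : j - 1 < i) : MvPolynomial (Fin i) (ZMod p) :=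
  X (⟨j - 1, h⟩ : Fin i) ^ p - X (⟨j - 1, h⟩ : Fin i) -
    rename (Fin.castLE (le_of_lt h)) (D j)

/-- The set of generators `X_1, ..., X_i` of `R_i ⊆ S_i`. -/
noncomputable def XeltSet (p : ℕ) (D : (j : ℕ) → MvPolynomial (Fin (j - 1)) (ZMod p))
    (i : ℕ) : Set (MvPolynomial (Fin i) (ZMod p)) :=
  {q | ∃ (j : ℕ) (h1 : 1 ≤ j) (h2 : j ≤ i), q = Xelt p D i j (by omega)}

open MvPolynomial in
/-- The family `D_1, ..., D_n` satisfies the conditions of Saltman's generic construction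
(Proposition 3.5 of the paper). -/
def IsSaltmanFamily (p n : ℕ) (G : Type*) [Group G]
    (Gser : ℕ → Subgroup G) [∀ j, (Gser j).Normal]
    (D : (j : ℕ) → MvPolynomial (Fin (j - 1)) (ZMod p)) : Prop :=
  (∀ i, 1 ≤ i → i ≤ n →
    (splitAt Gser i → D i = 0) ∧
    (¬ splitAt Gser i → ∀ c : ZMod p, D i ≠ C c)) ∧
  ∃ ρ : (i : ℕ) → (G ⧸ Gser i) →* RingAut (MvPolynomial (Fin i) (ZMod p)),
    ∀ i, 1 ≤ i → i ≤ n →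
      Function.Injective (ρ i) ∧
      (∀ q : MvPolynomial (Fin i) (ZMod p),
        (∀ g : G ⧸ Gser i, ρ i g q = q) ↔
          q ∈ Algebra.adjoin (ZMod p) (XeltSet p D i)) ∧
      (∀ M : Ideal (MvPolynomial (Fin i) (ZMod p)), M.IsMaximal →
        ∀ g : G ⧸ Gser i, g ≠ 1 →
          ∃ s : MvPolynomial (Fin i) (ZMod p), ρ i g s - s ∉ M) ∧
      (∀ g : G, ∀ q : MvPolynomial (Fin (i - 1)) (ZMod p),
        ρ i (QuotientGroup.mk g) (rename (Fin.castLE (Nat.sub_le i 1)) q) =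
          rename (Fin.castLE (Nat.sub_le i 1)) (ρ (i - 1) (QuotientGroup.mk g) q))

/-- The set {α_1, ..., α_i}. -/
def towerSet {L : Type*} (α : ℕ → L) (i : ℕ) : Set L :=
  {x | ∃ j, 1 ≤ j ∧ j ≤ i ∧ x = α j}

/-- The tower of fields K_i = K(α_1, ..., α_i) inside L = K_n. -/
noncomputable def towerField (K : Type*) {L : Type*} [Field K] [Field L] [Algebra K L]
    (α : ℕ → L) (i : ℕ) : IntermediateField K L :=
  IntermediateField.adjoin K (towerSet α i)



namespace TR

section valuation
variable {L : Type*} [Field L]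

/-- `v x ≥ N`, with `v 0 = ∞`. -/
def ge (V : DVal L) (x : L) (N : ℤ) : Prop := x = 0 ∨ N ≤ V.v x

/-- `x ≠ 0` and `v x = N`. -/
def ex (V : DVal L) (x : L) (N : ℤ) : Prop := x ≠ 0 ∧ V.v x = N

variable {V : DVal L}

lemma v_neg_one : V.v (-1 : L) = 0 := by
  have h := V.v_mul (-1) (-1) (by simp) (by simp)
  have h1 := V.v_one
  simp only [mul_neg, mul_one, neg_neg] at h
  omega

lemma ex.ge {x : L} {N : ℤ} (h : ex V x N) : ge V x N := Or.inr h.2.ge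

lemma ge.mono {x : L} {N M : ℤ} (h : ge V x N) (hM : M ≤ N) : ge V x M := by
  rcases h with h | h
  · exact Or.inl h
  · exact Or.inr (hM.trans h)

lemma ex.le_of_ge {x : L} {N M : ℤ} (h : ex V x N) (h' : TR.ge V x M) : M ≤ N := by
  rcases h' with h' | h'
  · exact absurd h' h.1
  · rw [← h.2]; exact h'

lemma ex.unique {x : L} {N M : ℤ} (h : ex V x N) (h' : ex V x M) : N = M := by
  rw [← h.2, ← h'.2]

lemma ex_self {x : L} (h : x ≠ 0) : ex V x (V.v x) := ⟨h, rfl⟩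

lemma ge_zero (N : ℤ) : ge V 0 N := Or.inl rfl

lemma ex_one : ex V (1 : L) 0 := ⟨one_ne_zero, V.v_one⟩

lemma ex.mul {x y : L} {N M : ℤ} (hx : ex V x N) (hy : ex V y M) : ex V (x * y) (N + M) := by
  refine ⟨mul_ne_zero hx.1 hy.1, ?_⟩
  rw [V.v_mul _ _ hx.1 hy.1, hx.2, hy.2]

lemma ex_neg_one : ex V (-1 : L) 0 := ⟨by simp, v_neg_one⟩

lemma ex.neg {x : L} {N : ℤ} (hx : ex V x N) : ex V (-x) N := by
  have := ex_neg_one.mul hx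
  simpa using this

lemma ge.mul {x y : L} {N M : ℤ} (hx : ge V x N) (hy : ge V y M) : ge V (x * y) (N + M) := by
  rcases hx with rfl | hx
  · left; simp
  rcases hy with rfl | hy
  · left; simp
  by_cases h : x = 0
  · left; simp [h]
  by_cases h' : y = 0
  · left; simp [h']
  right
  rw [V.v_mul _ _ h h']; omega

lemma ge.neg {x : L} {N : ℤ} (hx : ge V x N) : ge V (-x) N := by
  have := (ex_neg_one (V := V)).ge.mul hx
  simpa using this

lemma ge.add {x y : L} {N : ℤ} (hx : ge V x N) (hy : ge V y N) : ge V (x + y) N := by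
  by_cases h : x = 0
  · simpa [h] using hy
  by_cases h' : y = 0
  · simpa [h'] using hx
  by_cases h'' : x + y = 0
  · left; exact h''
  right
  have := V.v_add x y h h' h''
  rcases hx with hx | hx
  · contradiction
  rcases hy with hy | hy
  · contradiction
  exact (le_min hx hy).trans this

lemma ge.sub {x y : L} {N : ℤ} (hx : ge V x N) (hy : ge V y N) : ge V (x - y) N := by
  rw [sub_eq_add_neg]; exact hx.add hy.neg

lemma ge_sum {ι : Type*} (s : Finset ι) (f : ι → L) {N : ℤ} (h : ∀ i ∈ s, ge V (f i) N) :
    ge V (∑ i ∈ s, f i) N := by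
  classical
  induction s using Finset.induction_on with
  | empty => simpa using ge_zero N
  | insert a s ha ih =>
    rw [Finset.sum_insert ha]
    exact (h a (by simp)).add (ih fun i hi => h i (by simp [hi]))

lemma ex.pow {x : L} {N : ℤ} (hx : ex V x N) (k : ℕ) : ex V (x ^ k) (k * N) := by
  induction k with
  | zero => simpa using ex_one
  | succ k ih =>
    have := ih.mul hx
    rw [pow_succ]
    convert this using 1
    push_cast; ring

lemma ge.pow {x : L} {N : ℤ} (hx : ge V x N) (k : ℕ) : ge V (x ^ k) (k * N) := by
  induction k with
  | zero => simpa using (ex_one (V := V)).ge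
  | succ k ih =>
    have := ih.mul hx
    rw [pow_succ]
    convert this using 1
    push_cast; ring

lemma ex.inv {x : L} {N : ℤ} (hx : ex V x N) : ex V x⁻¹ (-N) := by
  have h := V.v_mul x x⁻¹ hx.1 (inv_ne_zero hx.1)
  rw [mul_inv_cancel₀ hx.1, V.v_one, hx.2] at h
  exact ⟨inv_ne_zero hx.1, by omega⟩

lemma ex.zpow {x : L} {N : ℤ} (hx : ex V x N) (k : ℤ) : ex V (x ^ k) (k * N) := by
  obtain ⟨m, rfl | rfl⟩ := k.eq_nat_or_neg
  · simpa using hx.pow m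
  · simpa using (hx.pow m).inv

lemma ex.div {x y : L} {N M : ℤ} (hx : ex V x N) (hy : ex V y M) : ex V (x / y) (N - M) := by
  rw [div_eq_mul_inv, sub_eq_add_neg]; exact hx.mul hy.inv

lemma ex.add_ge {x y : L} {N : ℤ} (hx : ex V x N) (hy : TR.ge V y (N + 1)) :
    ex V (x + y) N := by
  have h1 : TR.ge V (x + y) N := hx.ge.add (hy.mono (by omega))
  have h0 : x + y ≠ 0 := by
    intro h0
    have : x = -y := eq_neg_of_add_eq_zero_left h0
    have h2 := hx.le_of_ge (this ▸ hy.neg)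
    omega
  refine ⟨h0, ?_⟩
  rcases h1 with h1 | h1
  · contradiction
  by_contra hne
  have h3 : TR.ge V (x + y) (N + 1) := Or.inr (by omega)
  have h4 := h3.sub hy
  rw [add_sub_cancel_right] at h4
  have := hx.le_of_ge h4
  omega

lemma ex.add_ge' {x y : L} {N M : ℤ} (hx : ex V x N) (hy : TR.ge V y M) (h : N < M) :
    ex V (x + y) N := hx.add_ge (hy.mono (by omega))

lemma ex.congr {x y : L} {N M : ℤ} (hx : ex V x N) (hxy : TR.ge V (y - x) M) (h : N < M) :
    ex V y N := by
  have := hx.add_ge' hxy h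
  simpa using this

lemma ex_of_ge_not {x : L} {N : ℤ} (h : ge V x N) (h' : ¬ ge V x (N + 1)) : ex V x N := by
  rcases h with h | h
  · exact absurd (Or.inl h) h'
  refine ⟨fun h0 => h' (Or.inl h0), ?_⟩
  by_contra hne
  exact h' (Or.inr (by omega))

lemma ge_natCast (k : ℕ) : ge V (k : L) 0 := by
  induction k with
  | zero => simpa using ge_zero 0
  | succ k ih => push_cast; exact ih.add ex_one.ge

lemma ex_natCast (p : ℕ) (hp : p.Prime) [CharP L p] (k : ℕ) (hk : ¬ p ∣ k) :
    ex V (k : L) 0 := by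
  have hk0 : (k : L) ≠ 0 := by
    rwa [Ne, CharP.cast_eq_zero_iff L p]
  have hco : Nat.Coprime k p := ((Nat.Prime.coprime_iff_not_dvd hp).2 hk).symm
  obtain ⟨m, hm⟩ := Nat.exists_mul_mod_eq_one_of_coprime hco hp.one_lt
  have h1 : (k : L) * (m : L) = 1 := by
    have : ((k * m : ℕ) : L) = ((1 : ℕ) : L) := by
      rw [CharP.natCast_eq_natCast L p]
      rw [Nat.ModEq, hm.2]
      exact (Nat.mod_eq_of_lt hp.one_lt).symm
    exact_mod_cast this
  have hm0 : (m : L) ≠ 0 := by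
    intro h; rw [h] at h1; simp at h1
  have h2 := (ex_self (V := V) hk0).mul (ex_self hm0)
  rw [h1] at h2
  have h3 := h2.unique ex_one
  have h4 := (ex_self (V := V) hk0).le_of_ge (ge_natCast k)
  have h5 := (ex_self (V := V) hm0).le_of_ge (ge_natCast m)
  exact ⟨hk0, by omega⟩

lemma ge_one_add_pow {w : L} {N : ℤ} (hN : 0 ≤ N) (hw : ge V w N) (k : ℕ) :
    ge V ((1 + w) ^ k - 1) N := by
  have h := geom_sum_mul (1 + w) k
  rw [← h]
  have hg : ge V (∑ i ∈ Finset.range k, (1 + w) ^ i) 0 := by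
    apply ge_sum
    intro i _
    have : ge V (1 + w) 0 := ex_one.ge.add (hw.mono hN)
    simpa using this.pow i
  have := hg.mul hw
  simpa using this

lemma ex_one_add_pow (p : ℕ) (hp : p.Prime) [CharP L p] {w : L} {N : ℤ} (hN : 0 < N)
    (hw : ex V w N) (k : ℕ) (hk : ¬ p ∣ k) : ex V ((1 + w) ^ k - 1) N := by
  have h := geom_sum_mul (1 + w) k
  rw [← h]
  have hg : ex V (∑ i ∈ Finset.range k, (1 + w) ^ i) 0 := by
    refine (ex_natCast p hp k hk).congr (M := N) ?_ hN
    have : (∑ i ∈ Finset.range k, (1 + w) ^ i) - (k : L)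
        = ∑ i ∈ Finset.range k, ((1 + w) ^ i - 1) := by
      simp
    rw [this]
    exact ge_sum _ _ fun i _ => ge_one_add_pow hN.le hw.ge i
  have := hg.mul hw
  simpa using this

/-- Artin-Schreier: valuation of a root. -/
lemma ex_artin_schreier (p : ℕ) (hp : p.Prime) {x : L} {t : ℤ} (ht : 0 < t)
    (h : ex V (x ^ p - x) (-t)) : ∃ q : ℤ, p * q = -t ∧ ex V x q := by
  have hx : x ≠ 0 := by
    rintro rfl
    apply h.1
    simp [hp.ne_zero]
  have hv := ex_self (V := V) hx
  set q := V.v x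
  have hp2 : (2 : ℤ) ≤ p := by exact_mod_cast hp.two_le
  have hq : q < 0 := by
    by_contra hq
    push Not at hq
    have h1 : ge V (x ^ p - x) 0 := by
      have h2 := (hv.ge.mono hq)
      have h3 := h2.pow p
      rw [mul_zero] at h3
      exact h3.sub h2
    have := h.le_of_ge h1
    omega
  have h1 : ex V (x ^ p - x) (p * q) := by
    rw [sub_eq_add_neg]
    refine (hv.pow p).add_ge' hv.neg.ge ?_
    nlinarith
  exact ⟨q, h1.unique h, hv⟩

lemma sum_dom {ι : Type*} (s : Finset ι) (f : ι → L)
    (h : ∀ i ∈ s, ∀ j ∈ s, f i ≠ 0 → f j ≠ 0 → V.v (f i) = V.v (f j) → i = j) :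
    (∀ i ∈ s, f i = 0) ∨ ∃ k ∈ s, f k ≠ 0 ∧ ex V (∑ i ∈ s, f i) (V.v (f k)) ∧
      ∀ l ∈ s, l ≠ k → ge V (f l) (V.v (f k) + 1) := by
  classical
  by_cases h0 : ∀ i ∈ s, f i = 0
  · exact Or.inl h0
  right
  push Not at h0
  obtain ⟨i0, hi0, hf0⟩ := h0
  obtain ⟨k, hk, hmin⟩ := Finset.exists_min_image (s.filter fun i => f i ≠ 0)
    (fun i => V.v (f i)) ⟨i0, by simp [hi0, hf0]⟩
  simp only [Finset.mem_filter] at hk hmin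
  have hl : ∀ l ∈ s, l ≠ k → ge V (f l) (V.v (f k) + 1) := by
    intro l hl hlk
    by_cases hfl : f l = 0
    · exact Or.inl hfl
    right
    have h1 := hmin l ⟨hl, hfl⟩
    have h2 : V.v (f l) ≠ V.v (f k) := fun he => hlk (h l hl k hk.1 hfl hk.2 he)
    omega
  refine ⟨k, hk.1, hk.2, ?_, hl⟩
  rw [← Finset.add_sum_erase s f hk.1]
  apply (ex_self hk.2).add_ge
  apply ge_sum
  intro i hi
  exact hl i (Finset.mem_of_mem_erase hi) (Finset.ne_of_mem_erase hi)

lemma ge_of_sum {ι : Type*} (s : Finset ι) (f : ι → L)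
    (h : ∀ i ∈ s, ∀ j ∈ s, f i ≠ 0 → f j ≠ 0 → V.v (f i) = V.v (f j) → i = j)
    {N : ℤ} (hs : ge V (∑ i ∈ s, f i) N) : ∀ i ∈ s, ge V (f i) N := by
  rcases sum_dom s f h with h0 | ⟨k, hk, hk0, hex, hl⟩
  · intro i hi; exact Or.inl (h0 i hi)
  · intro i hi
    have := hex.le_of_ge hs
    by_cases hik : i = k
    · subst hik; exact Or.inr this
    · exact (hl i hi hik).mono (by omega)

end valuation

end TR


namespace TR

section step
variable {K L : Type*} [Field K] [Field L] [Algebra K L]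

/-- `M` has value group `ε ℤ` and perfect residue field. -/
structure Lev (V : DVal L) (p : ℕ) (M : IntermediateField K L) (ε : ℤ) : Prop where
  pos : 0 < ε
  dvd : ∀ x ∈ M, x ≠ 0 → ε ∣ V.v x
  unif : ∃ x ∈ M, ex V x ε
  perf : ∀ x ∈ M, ge V x 0 → ∃ y ∈ M, ge V y 0 ∧ ge V (x - y ^ p) 1

/-- A totally ramified Artin-Schreier step. -/
structure Stp (V : DVal L) (p : ℕ) (M E : IntermediateField K L) (ε ε' s : ℤ) (β : L) : Prop where
  mem : β ^ p - β ∈ M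
  exA : ex V (β ^ p - β) (-(s * ε))
  exb : ex V β (-(s * ε'))
  spos : 0 < s
  ndvd : ¬ (p : ℤ) ∣ s
  eps : ε = p * ε'
  hE : E = M ⊔ IntermediateField.adjoin K {β}

variable {V : DVal L} {p : ℕ} {M E : IntermediateField K L} {ε ε' s : ℤ} {β : L}

lemma Lev.exists_ex (h : Lev V p M ε) (z : ℤ) : ∃ x ∈ M, ex V x (z * ε) := by
  obtain ⟨x, hx, hex⟩ := h.unif
  exact ⟨x ^ z, zpow_mem hx z, hex.zpow z⟩

lemma Lev.ge_succ (h : Lev V p M ε) {x : L} (hx : x ∈ M) {z : ℤ} (hg : ge V x (z * ε + 1)) :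
    ge V x ((z + 1) * ε) := by
  by_cases h0 : x = 0
  · exact Or.inl h0
  rcases hg with hg | hg
  · exact Or.inl hg
  right
  obtain ⟨c, hc⟩ := h.dvd x hx h0
  have := h.pos
  rw [hc] at hg ⊢
  have : z < c := by
    by_contra hcz
    push Not at hcz
    nlinarith
  nlinarith

lemma Lev.ex_of (h : Lev V p M ε) {x : L} (hx : x ∈ M) {z : ℤ} (hg : ge V x (z * ε))
    (hn : ¬ ge V x ((z + 1) * ε)) : ex V x (z * ε) := by
  refine ex_of_ge_not hg fun h1 => hn (h.ge_succ hx h1)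

/-- approximation by `f ^ p * g` -/
lemma Lev.approx (h : Lev V p M ε) (hp : p.Prime) {a g : L} (ha : a ∈ M) (hg : g ∈ M) {N N' z : ℤ}
    (hN : ex V a N) (hN' : ex V g N') (hz : N - N' = p * (z * ε)) :
    ∃ f ∈ M, ex V f (z * ε) ∧ ge V (a - f ^ p * g) (N + 1) := by
  obtain ⟨x, hx, hex⟩ := h.exists_ex z
  have hq : ex V (x ^ p * g) N := by
    have := (hex.pow p).mul hN'
    rwa [show (p : ℤ) * (z * ε) + N' = N by omega] at this
  have hq0 : ex V (a / (x ^ p * g)) 0 := by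
    have := hN.div hq
    rwa [sub_self] at this
  obtain ⟨y, hy, hy0, hy1⟩ := h.perf _ (div_mem ha (mul_mem (pow_mem hx p) hg)) hq0.ge
  have hyp : ex V (y ^ p) 0 := by
    refine hq0.congr (M := 1) ?_ one_pos
    have := hy1.neg
    rwa [neg_sub] at this
  have hyne : y ≠ 0 := by
    rintro rfl
    apply hyp.1
    simp [hp.ne_zero]
  have hye : ex V y 0 := by
    refine ⟨hyne, ?_⟩
    have h1 := ((ex_self (V := V) hyne).pow p).unique hyp
    rcases mul_eq_zero.1 h1 with h2 | h2
    · exact absurd h2 (by exact_mod_cast hp.ne_zero)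
    · exact h2
  refine ⟨x * y, mul_mem hx hy, ?_, ?_⟩
  · have := hex.mul hye
    rwa [add_zero] at this
  · have h1 := hq.ge.mul hy1
    have h2 : x ^ p * g * (a / (x ^ p * g) - y ^ p) = a - (x * y) ^ p * g := by
      have := hq.1
      rw [mul_sub, mul_div_cancel₀ _ this]
      ring
    rwa [h2] at h1

lemma Stp.pos (st : Stp V p M E ε ε' s β) (hM : Lev V p M ε) (hp : p.Prime) : 0 < ε' := by
  have h1 := hM.pos
  rw [st.eps] at h1
  have : (0 : ℤ) < p := by exact_mod_cast hp.pos
  exact pos_of_mul_pos_right h1 this.le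

lemma Stp.le (st : Stp V p M E ε ε' s β) : M ≤ E := by
  rw [st.hE]; exact le_sup_left

lemma Stp.bmem (st : Stp V p M E ε ε' s β) : β ∈ E := by
  rw [st.hE]
  have : β ∈ IntermediateField.adjoin K {β} := IntermediateField.mem_adjoin_simple_self K β
  exact (le_sup_right : IntermediateField.adjoin K {β} ≤ _) this

/-- constructing a step -/
lemma Stp.mk' (hM : Lev V p M ε) (hp : p.Prime) (mem : β ^ p - β ∈ M)
    (exA : ex V (β ^ p - β) (-(s * ε))) (spos : 0 < s) (ndvd : ¬ (p : ℤ) ∣ s) :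
    ∃ ε', Stp V p M (M ⊔ IntermediateField.adjoin K {β}) ε ε' s β := by
  obtain ⟨q, hq, hex⟩ := ex_artin_schreier p hp (mul_pos spos hM.pos) exA
  have hpi : Prime (p : ℤ) := Nat.prime_iff_prime_int.1 hp
  have h1 : (p : ℤ) ∣ s * ε := ⟨-q, by linarith⟩
  rcases hpi.dvd_or_dvd h1 with h2 | h2
  · contradiction
  obtain ⟨ε', rfl⟩ := h2
  refine ⟨ε', mem, exA, ?_, spos, ndvd, rfl, rfl⟩
  have : q = -(s * ε') := by
    have hp0 : (p : ℤ) ≠ 0 := hpi.ne_zero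
    apply mul_left_cancel₀ hp0
    rw [hq]; ring
  rwa [← this]

open Polynomial in
lemma exists_sum_of_mem (hp : p.Prime) (hA : β ^ p - β ∈ M) {x : L}
    (hx : x ∈ M ⊔ IntermediateField.adjoin K {β}) :
    ∃ c : ℕ → L, (∀ k, c k ∈ M) ∧ x = ∑ k ∈ Finset.range p, c k * β ^ k := by
  rw [← IntermediateField.restrictScalars_adjoin_eq_sup] at hx
  rw [IntermediateField.mem_restrictScalars] at hx
  set g : M[X] := X ^ p - X - C ⟨_, hA⟩ with hg
  have hdeg : (X + C ⟨_, hA⟩ : M[X]).degree < p := by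
    rw [degree_X_add_C]; exact_mod_cast hp.one_lt
  have hmon : g.Monic := by
    rw [hg, sub_sub]
    exact monic_X_pow_sub hdeg
  have hgd : g.natDegree = p := by
    rw [hg, sub_sub]
    exact natDegree_eq_of_degree_eq_some
      ((degree_sub_eq_left_of_degree_lt (by simpa using hdeg)).trans (by simp))
  have hroot : aeval β g = 0 := by
    simp [hg]
  have halg : IsIntegral M β := ⟨g, hmon, by simpa [aeval_def] using hroot⟩
  have hx' : x ∈ (IntermediateField.adjoin M {β}).toSubalgebra := hx
  rw [IntermediateField.adjoin_simple_toSubalgebra_of_isAlgebraic halg.isAlgebraic,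
    Algebra.adjoin_singleton_eq_range_aeval] at hx'
  obtain ⟨f, rfl⟩ := hx'
  refine ⟨fun k => ((f %ₘ g).coeff k : L), fun k => SetLike.coe_mem _, ?_⟩
  have h1 : aeval β f = aeval β (f %ₘ g) := by
    conv_lhs => rw [← modByMonic_add_div f g]
    simp [hroot]
  have h2 : (f %ₘ g).natDegree < p := by
    have := natDegree_modByMonic_lt f hmon (by
      intro h; rw [h] at hgd; simp at hgd; exact hp.ne_zero hgd.symm)
    rwa [hgd] at this
  change aeval β f = _
  rw [h1, aeval_eq_sum_range' h2]
  rfl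

lemma Stp.term_val (st : Stp V p M E ε ε' s β) (hM : Lev V p M ε) {c : L} (hc : c ∈ M)
    (hc0 : c ≠ 0) (k : ℕ) : ∃ z : ℤ, ex V (c * β ^ k) ((p * z - k * s) * ε') := by
  obtain ⟨z, hz⟩ := hM.dvd c hc hc0
  refine ⟨z, ?_⟩
  have := (ex_self (V := V) hc0).mul (st.exb.pow k)
  rw [hz, st.eps] at this
  convert this using 1
  ring

lemma Stp.distinct (st : Stp V p M E ε ε' s β) (hM : Lev V p M ε) (hp : p.Prime) (c : ℕ → L)
    (hc : ∀ k, c k ∈ M) : ∀ i ∈ Finset.range p, ∀ j ∈ Finset.range p, c i * β ^ i ≠ 0 →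
      c j * β ^ j ≠ 0 → V.v (c i * β ^ i) = V.v (c j * β ^ j) → i = j := by
  intro i hi j hj hi0 hj0 he
  obtain ⟨z, hz⟩ := st.term_val hM (hc i) (left_ne_zero_of_mul hi0) i
  obtain ⟨w, hw⟩ := st.term_val hM (hc j) (left_ne_zero_of_mul hj0) j
  rw [hz.2, hw.2] at he
  have h1 := mul_right_cancel₀ (st.pos hM hp).ne' he
  have hpi : Prime (p : ℤ) := Nat.prime_iff_prime_int.1 hp
  have h2 : (p : ℤ) ∣ (i - j) * s := ⟨z - w, by linarith⟩
  rcases hpi.dvd_or_dvd h2 with h3 | h3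
  · simp only [Finset.mem_range] at hi hj
    have h4 : (i : ℤ) - j = 0 := by
      apply Int.eq_zero_of_abs_lt_dvd h3
      rw [abs_lt]; constructor <;> omega
    omega
  · exact absurd h3 st.ndvd

lemma Stp.lev (st : Stp V p M E ε ε' s β) (hM : Lev V p M ε) (hp : p.Prime) : Lev V p E ε' := by
  have hpos := st.pos hM hp
  have hpi : Prime (p : ℤ) := Nat.prime_iff_prime_int.1 hp
  refine ⟨hpos, ?_, ?_, ?_⟩
  · intro x hx hx0
    rw [st.hE] at hx
    obtain ⟨c, hc, rfl⟩ := exists_sum_of_mem hp st.mem hx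
    rcases sum_dom _ _ (st.distinct hM hp c hc) with h0 | ⟨k, hk, hk0, hex, _⟩
    · exact absurd (Finset.sum_eq_zero h0) hx0
    · obtain ⟨z, hz⟩ := st.term_val hM (hc k) (left_ne_zero_of_mul hk0) k
      rw [hex.2, hz.2]
      exact dvd_mul_left _ _
  · obtain ⟨x, hx, hex⟩ := hM.unif
    have hco : IsCoprime (p : ℤ) s := (Prime.coprime_iff_not_dvd hpi).2 st.ndvd
    obtain ⟨a, b, hab⟩ := hco
    refine ⟨x ^ a * β ^ (-b), mul_mem (zpow_mem (st.le hx) _) (zpow_mem st.bmem _), ?_⟩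
    have := (hex.zpow a).mul (st.exb.zpow (-b))
    rw [st.eps] at this
    convert this using 1
    linear_combination (-ε') * hab
  · intro x hx hx0
    rw [st.hE] at hx
    obtain ⟨c, hc, rfl⟩ := exists_sum_of_mem hp st.mem hx
    have hge := ge_of_sum _ _ (st.distinct hM hp c hc) hx0
    have h0r : 0 ∈ Finset.range p := by simpa using hp.pos
    have h0 := hge 0 h0r
    simp only [pow_zero, mul_one] at h0
    obtain ⟨y, hy, hy0, hy1⟩ := hM.perf _ (hc 0) h0
    refine ⟨y, st.le hy, hy0, ?_⟩
    rw [← Finset.add_sum_erase _ _ h0r]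
    have : c 0 * β ^ 0 + ∑ k ∈ (Finset.range p).erase 0, c k * β ^ k - y ^ p
        = (c 0 - y ^ p) + ∑ k ∈ (Finset.range p).erase 0, c k * β ^ k := by ring
    rw [this]
    refine hy1.add (ge_sum _ _ ?_)
    intro k hk
    have hk1 := Finset.mem_of_mem_erase hk
    have hk2 := Finset.ne_of_mem_erase hk
    have h3 := hge k hk1
    by_cases hck : c k = 0
    · left; simp [hck]
    obtain ⟨z, hz⟩ := st.term_val hM (hc k) hck k
    have h4 := hz.le_of_ge h3
    refine hz.ge.mono ?_
    rcases h4.lt_or_eq with h5 | h5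
    · omega
    · exfalso
      have h6 : (p : ℤ) * z - k * s = 0 := by
        rcases mul_eq_zero.1 h5.symm with h | h
        · exact h
        · omega
      have h7 : (p : ℤ) ∣ k * s := ⟨z, by linarith⟩
      rcases hpi.dvd_or_dvd h7 with h8 | h8
      · have h9 : p ∣ k := by exact_mod_cast h8
        exact absurd (Nat.le_of_dvd (Nat.pos_of_ne_zero hk2) h9) (by simpa using hk1)
      · exact st.ndvd h8

open Polynomial in
lemma Stp.indep (st : Stp V p M E ε ε' s β) (hM : Lev V p M ε) (hp : p.Prime) (f : M[X])
    (hf : f.natDegree < p) (h0 : aeval β f = 0) : f = 0 := by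
  rw [aeval_eq_sum_range' hf] at h0
  have h1 : ∑ k ∈ Finset.range p, (f.coeff k : L) * β ^ k = 0 := h0
  have hne : β ≠ 0 := st.exb.1
  rcases sum_dom _ _ (st.distinct hM hp (fun k => (f.coeff k : L)) fun k => SetLike.coe_mem _)
    with h2 | ⟨k, hk, hk0, hex, _⟩
  · ext k
    by_cases hk : k < p
    · have := h2 k (by simpa using hk)
      simp only [mul_eq_zero, pow_eq_zero_iff', hne, false_and, or_false] at this
      simpa using this
    · rw [coeff_eq_zero_of_natDegree_lt (by omega)]; simp
  · exact absurd h1 hex.1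

open Polynomial in
lemma Stp.finrank (st : Stp V p M E ε ε' s β) (hM : Lev V p M ε) (hp : p.Prime) :
    Module.finrank M (IntermediateField.adjoin M {β}) = p := by
  have hA := st.mem
  set g : M[X] := X ^ p - X - C ⟨_, hA⟩ with hg
  have hdeg : (X + C ⟨_, hA⟩ : M[X]).degree < p := by
    rw [degree_X_add_C]; exact_mod_cast hp.one_lt
  have hmon : g.Monic := by
    rw [hg, sub_sub]
    exact monic_X_pow_sub hdeg
  have hgd : g.natDegree = p := by
    rw [hg, sub_sub]
    exact natDegree_eq_of_degree_eq_some
      ((degree_sub_eq_left_of_degree_lt (by simpa using hdeg)).trans (by simp))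
  have hroot : aeval β g = 0 := by
    simp [hg]
  have halg : IsIntegral M β := ⟨g, hmon, by simpa [aeval_def] using hroot⟩
  rw [IntermediateField.adjoin.finrank halg]
  apply le_antisymm
  · rw [← hgd]
    exact natDegree_le_of_dvd (minpoly.dvd _ _ hroot) hmon.ne_zero
  · by_contra hlt
    push Not at hlt
    exact minpoly.ne_zero halg (st.indep hM hp _ hlt (minpoly.aeval _ _))

end step

end TR


namespace TR

section approx
variable {K L : Type*} [Field K] [Field L] [Algebra K L]
variable {V : DVal L} {p : ℕ} {M E : IntermediateField K L} {ε ε' s : ℤ} {β : L}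

lemma exists_mul_sub (hp : p.Prime) {s : ℤ} (hs : ¬ (p : ℤ) ∣ s) {R : ℤ} (hR : ¬ (p : ℤ) ∣ R) :
    ∃ k : ℕ, ¬ p ∣ k ∧ ∃ z : ℤ, R - k * s = p * z := by
  have hpi : Prime (p : ℤ) := Nat.prime_iff_prime_int.1 hp
  obtain ⟨a, b, hab⟩ := (Prime.coprime_iff_not_dvd hpi).2 hs
  have hp0 : (0 : ℤ) < p := by exact_mod_cast hp.pos
  have hnn : 0 ≤ (R * b) % p := Int.emod_nonneg _ hp0.ne'
  have hk : (((R * b) % p).toNat : ℤ) = (R * b) % p := Int.toNat_of_nonneg hnn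
  have hdm := Int.emod_add_mul_ediv (R * b) p
  have key : R - (((R * b) % p).toNat : ℤ) * s = p * (a * R + s * (R * b / p)) := by
    rw [hk]
    linear_combination (-R) * hab - s * hdm
  refine ⟨((R * b) % p).toNat, ?_, _, key⟩
  intro h
  apply hR
  have h' : (p : ℤ) ∣ (((R * b) % p).toNat : ℤ) := by exact_mod_cast h
  have h2 : (p : ℤ) ∣ R - (((R * b) % p).toNat : ℤ) * s := ⟨_, key⟩
  have := dvd_add h2 (h'.mul_right s)
  simpa using this

/-- decomposition of an element of valuation prime to `p` -/
lemma Stp.decomp [CharP L p] (st : Stp V p M E ε ε' s β) (hM : Lev V p M ε) (hp : p.Prime)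
    {a : L} (ha : a ∈ M) {R : ℤ} (hR : ¬ (p : ℤ) ∣ R) (hex : ex V a (-R * ε)) :
    ∃ c Q a' : L, c ∈ E ∧ a' ∈ M ∧ a = (c ^ p - c) + c + Q + a' ∧ ex V c (-R * ε') ∧
      ex V Q (-(p * R - (p - 1) * s) * ε') ∧ ge V a' ((-R + 1) * ε) := by
  obtain ⟨k, hk, z, hz⟩ := exists_mul_sub hp st.ndvd hR
  have heps := st.eps
  have hpos := st.pos hM hp
  obtain ⟨f, hf, hfex, hfge⟩ := hM.approx hp (z := -z) ha (pow_mem st.mem k) hex (st.exA.pow k)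
    (by linear_combination (-ε) * hz)
  have hβ0 : β ≠ 0 := st.exb.1
  have hp1 : (1 : ℤ) < p := by exact_mod_cast hp.one_lt
  -- `y = - β / β ^ p`
  have hy : ex V (-(β / β ^ p)) ((p - 1) * s * ε') := by
    have := (st.exb.div (st.exb.pow p)).neg
    convert this using 1
    ring
  have hy1 := ex_one_add_pow p hp (mul_pos (mul_pos (by omega) st.spos) hpos) hy k hk
  have hQ := ((hfex.pow p).mul (st.exb.pow (p * k))).mul hy1
  refine ⟨f * β ^ k, f ^ p * β ^ (p * k) * ((1 + -(β / β ^ p)) ^ k - 1), a - f ^ p * (β ^ p - β) ^ k, mul_mem (st.le hf) (pow_mem st.bmem k),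
    sub_mem ha (mul_mem (pow_mem hf p) (pow_mem st.mem k)), ?_, ?_, ?_, ?_⟩
  rotate_left
  · convert hfex.mul (st.exb.pow k) using 1
    rw [heps]
    linear_combination (-ε') * hz
  · convert hQ using 1
    rw [heps]
    push_cast
    linear_combination (-p * ε') * hz
  · exact hM.ge_succ (sub_mem ha (mul_mem (pow_mem hf p) (pow_mem st.mem k))) hfge
  · have h1 : (β ^ p - β) = β ^ p * (1 + -(β / β ^ p)) := by
      field_simp
      ring
    rw [h1]
    rw [mul_pow, pow_mul, mul_pow]
    ring

lemma wp_add [CharP L p] (hp : p.Prime) (x y : L) :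
    (x + y) ^ p - (x + y) = (x ^ p - x) + (y ^ p - y) := by
  have := Fact.mk hp
  rw [add_pow_char]; ring

lemma wp_sub [CharP L p] (hp : p.Prime) (x y : L) :
    (x - y) ^ p - (x - y) = (x ^ p - x) - (y ^ p - y) := by
  have := Fact.mk hp
  rw [sub_pow_char]; ring

lemma Stp.approx_le [CharP L p] (st : Stp V p M E ε ε' s β) (hM : Lev V p M ε) (hp : p.Prime)
    (r : ℕ) : ∀ a ∈ M, ge V a (-r * ε) →
      ∃ c ∈ E, ge V (a - (c ^ p - c)) (-(max (r : ℤ) (p * r - (p - 1) * s)) * ε') := by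
  have hpos := st.pos hM hp
  have hp1 : (1 : ℤ) < p := by exact_mod_cast hp.one_lt
  have hs := st.spos
  induction r with
  | zero =>
    intro a ha hg
    refine ⟨0, zero_mem _, ?_⟩
    have : max ((0 : ℕ) : ℤ) (p * (0 : ℕ) - (p - 1) * s) = 0 := by
      apply max_eq_left
      push_cast
      nlinarith
    rw [this]
    simpa [hp.ne_zero] using hg
  | succ r ih =>
    intro a ha hg
    have hmono : ∀ N : ℤ, N ≤ max ((r + 1 : ℕ) : ℤ) (p * (r + 1 : ℕ) - (p - 1) * s) →
        -(max ((r + 1 : ℕ) : ℤ) (p * (r + 1 : ℕ) - (p - 1) * s)) * ε' ≤ -N * ε' := by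
      intro N hN
      nlinarith
    have hmax : max (r : ℤ) (p * r - (p - 1) * s) ≤
        max ((r + 1 : ℕ) : ℤ) (p * (r + 1 : ℕ) - (p - 1) * s) := by
      apply max_le_max
      · push_cast; omega
      · push_cast; nlinarith
    by_cases hlow : ge V a (-r * ε)
    · obtain ⟨c, hc, h⟩ := ih a ha hlow
      exact ⟨c, hc, h.mono (hmono _ hmax)⟩
    have hexa : ex V a (-((r + 1 : ℕ) : ℤ) * ε) := by
      apply hM.ex_of ha hg
      convert hlow using 3
      push_cast; ring
    by_cases hdvd : (p : ℤ) ∣ ((r + 1 : ℕ) : ℤ)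
    · obtain ⟨z, hz⟩ := hdvd
      obtain ⟨f, hf, hfex, hfge⟩ := hM.approx hp (z := -z) ha (one_mem M) hexa ex_one
        (by rw [hz]; ring)
      have h1 : ge V (f + (a - f ^ p * 1)) (-r * ε) := by
        refine ge.add (hfex.ge.mono ?_) ?_
        · have := hM.pos
          have hzr : z ≤ r := by
            push_cast at hz
            nlinarith
          nlinarith
        · have := hM.ge_succ (sub_mem ha (mul_mem (pow_mem hf p) (one_mem M))) hfge
          convert this using 1
          push_cast; ring
      obtain ⟨c, hc, h⟩ := ih _ (add_mem hf (sub_mem ha (mul_mem (pow_mem hf p) (one_mem M)))) h1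
      refine ⟨f + c, add_mem (st.le hf) hc, ?_⟩
      rw [wp_add hp]
      have h2 := h.mono (hmono _ hmax)
      convert h2 using 1
      ring
    · obtain ⟨c, Q, a', hc, ha', heq, hcex, hQ, hge⟩ := st.decomp hM hp ha hdvd hexa
      obtain ⟨c', hc', h⟩ := ih a' ha' (by convert hge using 1; push_cast; ring)
      refine ⟨c + c', add_mem hc hc', ?_⟩
      rw [wp_add hp]
      have h2 := h.mono (hmono _ hmax)
      have h3 := hcex.ge.mono (hmono _ (le_max_left _ _))
      have h4 := hQ.ge.mono (hmono _ (le_max_right _ _))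
      have h5 := (h3.add h4).add h2
      convert h5 using 1
      rw [heq]; ring

lemma Stp.approx_ex [CharP L p] (st : Stp V p M E ε ε' s β) (hM : Lev V p M ε) (hp : p.Prime)
    {R : ℤ} (hR : s < R) (hRp : ¬ (p : ℤ) ∣ R) {a : L} (ha : a ∈ M) (hexa : ex V a (-(R * ε))) :
    ∃ c ∈ E, ex V (a - (c ^ p - c)) (-((p * R - (p - 1) * s) * ε')) := by
  have hpos := st.pos hM hp
  have hp1 : (1 : ℤ) < p := by exact_mod_cast hp.one_lt
  have hs := st.spos
  obtain ⟨c, Q, a', hc, ha', heq, hcex, hQ, hge⟩ := st.decomp hM hp ha hRp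
    (by convert hexa using 1; ring)
  have hr : ((R - 1).toNat : ℤ) = R - 1 := Int.toNat_of_nonneg (by omega)
  obtain ⟨c', hc', h⟩ := st.approx_le hM hp (R - 1).toNat a' ha'
    (by rw [hr]; convert hge using 1; ring)
  rw [hr] at h
  refine ⟨c + c', add_mem hc hc', ?_⟩
  rw [wp_add hp]
  have hlt : R < p * R - (p - 1) * s := by nlinarith
  have hlt2 : max (R - 1) (p * (R - 1) - (p - 1) * s) < p * R - (p - 1) * s := by
    apply max_lt
    · omega
    · nlinarith
  have h1 := (hQ.add_ge' hcex.ge (by nlinarith)).add_ge' h (by nlinarith)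
  convert h1 using 1
  · rw [heq]; ring
  · ring

end approx

end TR


namespace TR

/-- The numbers `B m r = ψ_{K_m/K}(r)` (for `r ≥ u_m`). -/
def Bf (p : ℕ) (u : ℕ → ℤ) : ℕ → ℤ → ℤ
  | 0, r => r
  | m + 1, r => p * Bf p u m r - (p - 1) * Bf p u m (u (m + 1))

lemma Bf_sub (p : ℕ) (u : ℕ → ℤ) (m : ℕ) (r r' : ℤ) :
    Bf p u m r - Bf p u m r' = (p : ℤ) ^ m * (r - r') := by
  induction m with
  | zero => simp [Bf]
  | succ m ih =>
    simp only [Bf]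
    rw [pow_succ]
    linear_combination (p : ℤ) * ih

section
variable {p n : ℕ} {u b : ℕ → ℤ}

lemma Bf_eq_b
    (hb1 : b 1 = u 1)
    (hbrec : ∀ i, 1 ≤ i → i + 1 ≤ n → b (i + 1) = b i + (p : ℤ) ^ i * (u (i + 1) - u i))
    (m : ℕ) (hm : m + 1 ≤ n) : b (m + 1) = Bf p u m (u (m + 1)) := by
  induction m with
  | zero => simpa [Bf] using hb1
  | succ m ih =>
    have ih := ih (by omega)
    have h1 := Bf_sub p u m (u (m + 1 + 1)) (u (m + 1))
    rw [hbrec (m + 1) (by omega) hm, ih]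
    simp only [Bf]
    rw [pow_succ]
    linear_combination (-p : ℤ) * h1

lemma Bf_ndvd (hp : p.Prime) (hu_ndvd : ∀ i, 1 ≤ i → i ≤ n → ¬ (p : ℤ) ∣ u i) (m : ℕ) (hm : m ≤ n) :
    ∀ R : ℤ, ¬ (p : ℤ) ∣ R → ¬ (p : ℤ) ∣ Bf p u m R := by
  induction m with
  | zero => intro R hR; simpa [Bf] using hR
  | succ m ih =>
    intro R hR h
    apply ih (by omega) _ (hu_ndvd (m + 1) (by omega) hm)
    simp only [Bf] at h
    have h2 : (p : ℤ) ∣ p * Bf p u m (u (m + 1)) - p * Bf p u m R := ⟨_, by rw [← mul_sub]⟩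
    have := dvd_add h h2
    have heq : (p : ℤ) * Bf p u m R - (p - 1) * Bf p u m (u (m + 1)) +
        (p * Bf p u m (u (m + 1)) - p * Bf p u m R) = Bf p u m (u (m + 1)) := by ring
    rwa [heq] at this

lemma b_pos_mono (hp : p.Prime) (hu_pos : ∀ i, 1 ≤ i → i ≤ n → 0 < u i)
    (hu_mono : ∀ i, 1 ≤ i → i + 1 ≤ n → u i < u (i + 1))
    (hb1 : b 1 = u 1)
    (hbrec : ∀ i, 1 ≤ i → i + 1 ≤ n → b (i + 1) = b i + (p : ℤ) ^ i * (u (i + 1) - u i)) :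
    (∀ i j, 1 ≤ i → i < j → j ≤ n → b i < b j) ∧ ∀ i, 1 ≤ i → i ≤ n → 0 < b i := by
  have hp0 : (0 : ℤ) < p := by exact_mod_cast hp.pos
  have hstep : ∀ i, 1 ≤ i → i + 1 ≤ n → b i < b (i + 1) := by
    intro i h1 h2
    rw [hbrec i h1 h2]
    have := mul_pos (pow_pos hp0 i) (sub_pos.2 (hu_mono i h1 h2))
    omega
  have hmono : ∀ i j, 1 ≤ i → i < j → j ≤ n → b i < b j := by
    intro i j hi hij hj
    induction j, hij using Nat.le_induction with
    | base => exact hstep i hi hj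
    | succ j hij ih => exact (ih (by omega)).trans (hstep j (by omega) hj)
  refine ⟨hmono, fun i hi hin => ?_⟩
  have h1 : 0 < b 1 := by rw [hb1]; exact hu_pos 1 le_rfl (by omega)
  rcases hi.lt_or_eq with h | h
  · exact h1.trans (hmono 1 i le_rfl h hin)
  · rwa [← h]

end

section tower
variable {K L : Type*} [Field K] [Field L] [Algebra K L]

lemma towerField_zero (α : ℕ → L) : towerField K α 0 = ⊥ := by
  have : towerSet α 0 = ∅ := by
    ext x; simp only [towerSet, Set.mem_ofPred_eq, Set.mem_empty_iff_false, iff_false]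
    rintro ⟨j, h1, h2, _⟩; omega
  rw [towerField, this, IntermediateField.adjoin_empty]

lemma towerField_succ (α : ℕ → L) (m : ℕ) :
    towerField K α (m + 1) = towerField K α m ⊔ IntermediateField.adjoin K {α (m + 1)} := by
  rw [towerField, towerField, ← IntermediateField.adjoin_union]
  congr 1
  ext x
  simp only [towerSet, Set.mem_ofPred_eq, Set.mem_union, Set.mem_singleton_iff]
  constructor
  · rintro ⟨j, h1, h2, rfl⟩
    rcases h2.lt_or_eq with h | h
    · left; exact ⟨j, h1, by omega, rfl⟩
    · right; rw [h]
  · rintro (⟨j, h1, h2, rfl⟩ | rfl)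
    · exact ⟨j, h1, by omega, rfl⟩
    · exact ⟨m + 1, by omega, le_rfl, rfl⟩

lemma towerField_mono (α : ℕ → L) {i j : ℕ} (h : i ≤ j) : towerField K α i ≤ towerField K α j := by
  apply IntermediateField.adjoin.mono
  rintro x ⟨k, h1, h2, rfl⟩
  exact ⟨k, h1, by omega, rfl⟩

lemma mem_towerField (α : ℕ → L) {i j : ℕ} (h1 : 1 ≤ i) (h : i ≤ j) : α i ∈ towerField K α j :=
  IntermediateField.subset_adjoin _ _ ⟨i, h1, h, rfl⟩

lemma sup_adjoin_eq {M : IntermediateField K L} {x y : L} (h : x - y ∈ M) :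
    M ⊔ IntermediateField.adjoin K {x} = M ⊔ IntermediateField.adjoin K {y} := by
  have key : ∀ x y : L, x - y ∈ M →
      M ⊔ IntermediateField.adjoin K {x} ≤ M ⊔ IntermediateField.adjoin K {y} := by
    intro x y h
    refine sup_le le_sup_left ?_
    rw [IntermediateField.adjoin_simple_le_iff]
    have h1 : x - y ∈ M ⊔ IntermediateField.adjoin K {y} :=
      (le_sup_left : M ≤ M ⊔ IntermediateField.adjoin K {y}) h
    have h2 : y ∈ M ⊔ IntermediateField.adjoin K {y} :=
      (le_sup_right : _ ≤ M ⊔ IntermediateField.adjoin K {y})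
        (IntermediateField.mem_adjoin_simple_self K y)
    have := add_mem h1 h2
    rwa [sub_add_cancel] at this
  refine le_antisymm (key x y h) (key y x ?_)
  rw [← neg_sub]; exact neg_mem h

lemma Stp.finrank_mul {V : DVal L} {p : ℕ} {M E : IntermediateField K L} {ε ε' s : ℤ} {β : L}
    (st : Stp V p M E ε ε' s β) (hM : Lev V p M ε) (hp : p.Prime) :
    Module.finrank K E = Module.finrank K M * p := by
  rw [st.hE, ← IntermediateField.restrictScalars_adjoin_eq_sup, ← st.finrank hM hp]
  exact (Module.finrank_mul_finrank K M (IntermediateField.adjoin M {β})).symm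

lemma lev_bot {p : ℕ} (vK : DVal K) (hperf : vK.PerfectResidue p) (vL : DVal L) (e : ℕ)
    (hepos : 0 < e)
    (he : ∀ x : K, x ≠ 0 → vL.v (algebraMap K L x) = e * vK.v x) :
    Lev vL p (⊥ : IntermediateField K L) e := by
  have hge : ∀ x : K, ∀ N : ℤ, ge vL (algebraMap K L x) (e * N) ↔ ge vK x N := by
    intro x N
    simp only [ge, map_eq_zero]
    by_cases h0 : x = 0
    · simp [h0]
    simp only [h0, false_or]
    rw [he x h0]
    exact mul_le_mul_iff_right₀ (by exact_mod_cast hepos)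
  refine ⟨by exact_mod_cast hepos, ?_, ?_, ?_⟩
  · intro x hx h0
    obtain ⟨y, rfl⟩ := IntermediateField.mem_bot.1 hx
    rw [he y (by simpa using h0)]
    exact dvd_mul_right _ _
  · obtain ⟨π, h0, h1⟩ := vK.exists_uniformizer
    refine ⟨algebraMap K L π, IntermediateField.algebraMap_mem _ _, by simpa using h0, ?_⟩
    rw [he π h0, h1, mul_one]
  · intro x hx h0
    obtain ⟨y, rfl⟩ := IntermediateField.mem_bot.1 hx
    obtain ⟨z, hz, hz'⟩ := hperf y ((hge y 0).1 (by simpa using h0))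
    refine ⟨algebraMap K L z, IntermediateField.algebraMap_mem _ _, ?_, ?_⟩
    · simpa using (hge z 0).2 hz
    · have := (hge (y - z ^ p) 1).2 hz'
      rw [map_sub, map_pow, mul_one] at this
      exact this.mono (by exact_mod_cast hepos)

/-- The data carried along the induction. -/
structure Dat (V : DVal L) (p : ℕ) (u : ℕ → ℤ) (α : ℕ → L) (e : ℤ) (m : ℕ) (ε : ℤ) : Prop where
  eps : e = p ^ m * ε
  lev : Lev V p (towerField K α m) ε
  fin : Module.finrank K (towerField K α m) = p ^ m
  app : ∀ R : ℤ, 0 < R → (1 ≤ m → u m < R) → ¬ (p : ℤ) ∣ R → ∀ x : K,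
    ex V (algebraMap K L x) (-(R * e)) →
      ∃ c ∈ towerField K α m, ex V (algebraMap K L x - (c ^ p - c)) (-(Bf p u m R * ε))

variable {p n : ℕ} {u b : ℕ → ℤ} {V : DVal L} {α d : ℕ → L} {a : ℕ → K} {e : ℤ}

lemma Dat.step [CharP L p] (hp : p.Prime)
    (hu_pos : ∀ i, 1 ≤ i → i ≤ n → 0 < u i)
    (hu_mono : ∀ i, 1 ≤ i → i + 1 ≤ n → u i < u (i + 1))
    (hu_ndvd : ∀ i, 1 ≤ i → i ≤ n → ¬ (p : ℤ) ∣ u i)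
    (hb1 : b 1 = u 1)
    (hbrec : ∀ i, 1 ≤ i → i + 1 ≤ n → b (i + 1) = b i + (p : ℤ) ^ i * (u (i + 1) - u i))
    (hexa : ∀ i, 1 ≤ i → i ≤ n → ex V (algebraMap K L (a i)) (-(u i * e)))
    (hdmem : ∀ m, m + 1 ≤ n → d (m + 1) ∈ towerField K α m)
    (hdge : ∀ m, m + 1 ≤ n → d (m + 1) = 0 ∨ -(b (m + 1) * e) < p ^ m * V.v (d (m + 1)))
    (hα : ∀ i, 1 ≤ i → i ≤ n → α i ^ p - α i = d i + algebraMap K L (a i))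
    {m : ℕ} {ε : ℤ} (hm : m + 1 ≤ n) (D : Dat (K := K) V p u α e m ε) :
    ∃ ε' β, Stp V p (towerField K α m) (towerField K α (m + 1)) ε ε' (b (m + 1)) β ∧
      α (m + 1) - β ∈ towerField K α m ∧ Dat (K := K) V p u α e (m + 1) ε' := by
  have hp0 : (0 : ℤ) < p := by exact_mod_cast hp.pos
  have hb := Bf_eq_b hb1 hbrec m hm
  have hbpos := (b_pos_mono hp hu_pos hu_mono hb1 hbrec).2 (m + 1) (by omega) hm
  have hbnd : ¬ (p : ℤ) ∣ b (m + 1) := by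
    rw [hb]; exact Bf_ndvd hp hu_ndvd m (by omega) _ (hu_ndvd _ (by omega) hm)
  obtain ⟨c, hc, hcex⟩ := D.app (u (m + 1)) (hu_pos _ (by omega) hm)
    (fun h => hu_mono m h hm) (hu_ndvd _ (by omega) hm) (a (m + 1)) (hexa _ (by omega) hm)
  rw [← hb] at hcex
  have hwp : (α (m + 1) - c) ^ p - (α (m + 1) - c)
      = (algebraMap K L (a (m + 1)) - (c ^ p - c)) + d (m + 1) := by
    rw [wp_sub hp, hα _ (by omega) hm]; ring
  have hmem : (α (m + 1) - c) ^ p - (α (m + 1) - c) ∈ towerField K α m := by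
    rw [hwp]
    exact add_mem (sub_mem (IntermediateField.algebraMap_mem _ _)
      (sub_mem (pow_mem hc p) hc)) (hdmem m hm)
  have hdg : ge V (d (m + 1)) (-(b (m + 1) * ε) + 1) := by
    rcases hdge m hm with h | h
    · exact Or.inl h
    right
    rw [D.eps] at h
    have hpm : (0 : ℤ) < p ^ m := pow_pos hp0 m
    have : -(b (m + 1) * ε) < V.v (d (m + 1)) := by
      by_contra hcon
      push Not at hcon
      have := mul_le_mul_of_nonneg_left hcon hpm.le
      linarith
    omega
  have hexA : ex V ((α (m + 1) - c) ^ p - (α (m + 1) - c)) (-(b (m + 1) * ε)) := by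
    rw [hwp]; exact hcex.add_ge hdg
  obtain ⟨ε', st⟩ := Stp.mk' D.lev hp hmem hexA hbpos hbnd
  have hE : towerField K α m ⊔ IntermediateField.adjoin K {α (m + 1) - c}
      = towerField K α (m + 1) := by
    rw [towerField_succ]
    apply sup_adjoin_eq
    rw [sub_sub_cancel_left]; exact neg_mem hc
  rw [hE] at st
  refine ⟨ε', _, st, by simpa using hc, ?_, st.lev D.lev hp, ?_, ?_⟩
  · rw [D.eps, st.eps]; ring
  · rw [st.finrank_mul D.lev hp, D.fin, pow_succ]
  · intro R hR0 hR hRp x hx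
    have hR := hR (by omega)
    obtain ⟨c1, hc1, hex1⟩ := D.app R hR0 (fun h => (hu_mono m h hm).trans hR) hRp x hx
    have hlt : b (m + 1) < Bf p u m R := by
      have h1 := Bf_sub p u m R (u (m + 1))
      have h2 := mul_pos (pow_pos hp0 m) (sub_pos.2 hR)
      rw [hb]; omega
    obtain ⟨c2, hc2, hex2⟩ := st.approx_ex D.lev hp hlt
      (Bf_ndvd hp hu_ndvd m (by omega) R hRp)
      (sub_mem (IntermediateField.algebraMap_mem _ _) (sub_mem (pow_mem hc1 p) hc1)) hex1
    refine ⟨c1 + c2, add_mem (st.le hc1) hc2, ?_⟩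
    rw [wp_add hp]
    simp only [Bf]
    rw [← hb]
    convert hex2 using 1
    ring

/-- The structure of the whole tower. -/
structure Tow (V : DVal L) (p n : ℕ) (b : ℕ → ℤ) (α β : ℕ → L) : Prop where
  lev : ∀ m, m ≤ n → Lev V p (towerField K α m) (p ^ (n - m))
  fin : ∀ m, m ≤ n → Module.finrank K (towerField K α m) = p ^ m
  stp : ∀ m, m + 1 ≤ n → Stp V p (towerField K α m) (towerField K α (m + 1))
    (p ^ (n - m)) (p ^ (n - (m + 1))) (b (m + 1)) (β (m + 1))
  dif : ∀ m, m + 1 ≤ n → α (m + 1) - β (m + 1) ∈ towerField K α m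

lemma exists_tow [CharP L p] (hp : p.Prime)
    (hu_pos : ∀ i, 1 ≤ i → i ≤ n → 0 < u i)
    (hu_mono : ∀ i, 1 ≤ i → i + 1 ≤ n → u i < u (i + 1))
    (hu_ndvd : ∀ i, 1 ≤ i → i ≤ n → ¬ (p : ℤ) ∣ u i)
    (hb1 : b 1 = u 1)
    (hbrec : ∀ i, 1 ≤ i → i + 1 ≤ n → b (i + 1) = b i + (p : ℤ) ^ i * (u (i + 1) - u i))
    (hlev : Lev V p (⊥ : IntermediateField K L) e)
    (hexa : ∀ i, 1 ≤ i → i ≤ n → ex V (algebraMap K L (a i)) (-(u i * e)))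
    (hdmem : ∀ m, m + 1 ≤ n → d (m + 1) ∈ towerField K α m)
    (hdge : ∀ m, m + 1 ≤ n → d (m + 1) = 0 ∨ -(b (m + 1) * e) < p ^ m * V.v (d (m + 1)))
    (hα : ∀ i, 1 ≤ i → i ≤ n → α i ^ p - α i = d i + algebraMap K L (a i))
    (hgen : towerField K α n = ⊤) :
    e = p ^ n ∧ ∃ β, Tow (K := K) V p n b α β := by
  have hp0 : (0 : ℤ) < p := by exact_mod_cast hp.pos
  have hdat : ∀ m, m ≤ n → ∃ ε, Dat (K := K) V p u α e m ε := by
    intro m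
    induction m with
    | zero =>
      intro _
      refine ⟨e, by simp, by rwa [towerField_zero], by simp [towerField_zero], ?_⟩
      intro R _ _ _ x hx
      exact ⟨0, zero_mem _, by simpa [hp.ne_zero, Bf] using hx⟩
    | succ m ih =>
      intro hm
      obtain ⟨ε, D⟩ := ih (by omega)
      obtain ⟨ε', _, _, _, D'⟩ := D.step hp hu_pos hu_mono hu_ndvd hb1 hbrec hexa hdmem hdge hα hm
      exact ⟨ε', D'⟩
  have he : e = p ^ n := by
    obtain ⟨ε, D⟩ := hdat n le_rfl
    obtain ⟨π, h0, h1⟩ := V.exists_uniformizer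
    have h2 := D.lev.dvd π (by rw [hgen]; trivial) h0
    rw [h1] at h2
    have := Int.eq_one_of_dvd_one D.lev.pos.le h2
    rw [D.eps, this, mul_one]
  refine ⟨he, ?_⟩
  have heps : ∀ m, m ≤ n → ∀ ε, e = p ^ m * ε → ε = p ^ (n - m) := by
    intro m hm ε h
    rw [he, ← Nat.add_sub_of_le hm, pow_add] at h
    have := mul_left_cancel₀ (pow_pos hp0 m).ne' h
    rw [← this]
  have hst : ∀ m, m + 1 ≤ n → ∃ β, Stp V p (towerField K α m) (towerField K α (m + 1))
    (p ^ (n - m)) (p ^ (n - (m + 1))) (b (m + 1)) β ∧ α (m + 1) - β ∈ towerField K α m := by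
    intro m hm
    obtain ⟨ε, D⟩ := hdat m (by omega)
    obtain ⟨ε', β, st, hd, D'⟩ :=
      D.step hp hu_pos hu_mono hu_ndvd hb1 hbrec hexa hdmem hdge hα hm
    rw [heps m (by omega) ε D.eps, heps (m + 1) hm ε' D'.eps] at st
    exact ⟨β, st, hd⟩
  choose! β hβ using hst
  refine ⟨fun i => β (i - 1), ?_, ?_, ?_, ?_⟩
  · intro m hm
    obtain ⟨ε, D⟩ := hdat m hm
    rw [← heps m hm ε D.eps]; exact D.lev
  · intro m hm
    obtain ⟨ε, D⟩ := hdat m hm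
    exact D.fin
  · intro m hm; exact (hβ m hm).1
  · intro m hm; exact (hβ m hm).2

end tower

end TR


namespace TR

section ram
variable {K L : Type*} [Field K] [Field L] [Algebra K L]
variable {V : DVal L} {p : ℕ} {M E : IntermediateField K L} {ε ε' s : ℤ} {β : L}

lemma ge_sigma {σ : L ≃ₐ[K] L} (hinv : ∀ x : L, V.v (σ x) = V.v x) {x : L} {N : ℤ}
    (h : ge V x N) : ge V (σ x) N := by
  rcases h with rfl | h
  · left; simp
  · right; rwa [hinv]

lemma ex_sigma {σ : L ≃ₐ[K] L} (hinv : ∀ x : L, V.v (σ x) = V.v x) {x : L} {N : ℤ}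
    (h : ex V x N) : ex V (σ x) N :=
  ⟨by simpa using h.1, by rw [hinv]; exact h.2⟩

lemma Stp.ram_term [CharP L p] (st : Stp V p M E ε ε' s β) (hM : Lev V p M ε) (hp : p.Prime)
    {σ : L ≃ₐ[K] L} (hinv : ∀ x : L, V.v (σ x) = V.v x) {j : ℤ} (hj : 0 < j)
    (hc : ∀ c ∈ M, c ≠ 0 → ge V (σ c - c) (V.v c + j * ε' + 1))
    (hβ : ex V (σ β - β) (-(s * ε') + j * ε')) {c : L} (hcM : c ∈ M) (hc0 : c ≠ 0) (k : ℕ) :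
    ge V (σ (c * β ^ k) - c * β ^ k) (V.v (c * β ^ k) + j * ε') ∧
    (¬ p ∣ k → ex V (σ (c * β ^ k) - c * β ^ k) (V.v (c * β ^ k) + j * ε')) := by
  have hpos := st.pos hM hp
  have hb0 : β ≠ 0 := st.exb.1
  have hcv := ex_self (V := V) hc0
  have hk := st.exb.pow k
  have hv := (hcv.mul hk).2
  have hw : ex V ((σ β - β) / β) (j * ε') := by
    have := hβ.div st.exb
    convert this using 1
    ring
  have heq : σ (c * β ^ k) - c * β ^ k
      = σ c * β ^ k * ((1 + (σ β - β) / β) ^ k - 1) + (σ c - c) * β ^ k := by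
    have h1 : 1 + (σ β - β) / β = σ β / β := by field_simp; ring
    rw [h1, div_pow, map_mul, map_pow]
    have : β ^ k ≠ 0 := pow_ne_zero _ hb0
    field_simp
    ring
  have h2 := (hc c hcM hc0).mul hk.ge
  have hs := (ex_sigma hinv hcv).mul hk
  rw [heq, hv]
  constructor
  · refine ge.add ?_ (h2.mono (by linarith))
    exact hs.ge.mul (ge_one_add_pow (by positivity) hw.ge k)
  · intro hpk
    refine ex.add_ge ?_ (h2.mono (by linarith))
    exact hs.mul (ex_one_add_pow p hp (by positivity) hw k hpk)

lemma Stp.ram [CharP L p] (st : Stp V p M E ε ε' s β) (hM : Lev V p M ε) (hp : p.Prime)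
    {σ : L ≃ₐ[K] L} (hinv : ∀ x : L, V.v (σ x) = V.v x) {j : ℤ} (hj : 0 < j)
    (hc : ∀ c ∈ M, c ≠ 0 → ge V (σ c - c) (V.v c + j * ε' + 1))
    (hβ : ex V (σ β - β) (-(s * ε') + j * ε')) {x : L} (hx : x ∈ E) (hx0 : x ≠ 0) :
    ge V (σ x - x) (V.v x + j * ε') ∧
    ∀ z : ℤ, V.v x = z * ε' → ¬ (p : ℤ) ∣ z → ex V (σ x - x) (V.v x + j * ε') := by
  have hpos := st.pos hM hp
  rw [st.hE] at hx
  obtain ⟨c, hcM, rfl⟩ := exists_sum_of_mem hp st.mem hx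
  rcases sum_dom _ _ (st.distinct hM hp c hcM) with h0 | ⟨k, hk, hk0, hex, hl⟩
  · exact absurd (Finset.sum_eq_zero h0) hx0
  have hsum : σ (∑ k ∈ Finset.range p, c k * β ^ k) - ∑ k ∈ Finset.range p, c k * β ^ k
      = (σ (c k * β ^ k) - c k * β ^ k) +
        ∑ l ∈ (Finset.range p).erase k, (σ (c l * β ^ l) - c l * β ^ l) := by
    rw [map_sum, ← Finset.sum_sub_distrib, ← Finset.add_sum_erase _ _ hk]
  have hrest : ge V (∑ l ∈ (Finset.range p).erase k, (σ (c l * β ^ l) - c l * β ^ l))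
      (V.v (c k * β ^ k) + j * ε' + 1) := by
    apply ge_sum
    intro l hlk
    have h1 := hl l (Finset.mem_of_mem_erase hlk) (Finset.ne_of_mem_erase hlk)
    by_cases hcl : c l = 0
    · left; simp [hcl]
    have hne : c l * β ^ l ≠ 0 := mul_ne_zero hcl (pow_ne_zero _ st.exb.1)
    have h2 := (ex_self (V := V) hne).le_of_ge h1
    exact (st.ram_term hM hp hinv hj hc hβ (hcM l) hcl l).1.mono (by linarith)
  have hck : c k ≠ 0 := left_ne_zero_of_mul hk0
  have hterm := st.ram_term hM hp hinv hj hc hβ (hcM k) hck k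
  rw [hsum, hex.2]
  constructor
  · exact hterm.1.add (hrest.mono (by linarith))
  · intro z hz hpz
    refine (hterm.2 ?_).add_ge hrest
    intro hpk
    apply hpz
    obtain ⟨w, hw⟩ := st.term_val hM (hcM k) hck k
    rw [hw.2] at hz
    have := mul_right_cancel₀ hpos.ne' hz
    rw [← this]
    have h3 : (p : ℤ) ∣ (k : ℤ) := by exact_mod_cast hpk
    exact dvd_sub (dvd_mul_right _ _) (h3.mul_right s)

variable {n : ℕ} {b : ℕ → ℤ} {α βs : ℕ → L}

lemma Tow.ram [CharP L p] (T : Tow (K := K) V p n b α βs) (hp : p.Prime)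
    (hbm : ∀ i j, 1 ≤ i → i < j → j ≤ n → b i < b j)
    {σ : L ≃ₐ[K] L} (hinv : ∀ x : L, V.v (σ x) = V.v x) {i : ℕ}
    (hin : i + 1 ≤ n) (hfix : ∀ x ∈ towerField K α i, σ x = x)
    (hnf : ¬ ∀ x ∈ towerField K α (i + 1), σ x = x) (m : ℕ) (him : i ≤ m) (hm : m + 1 ≤ n) :
    ∀ x ∈ towerField K α (m + 1), x ≠ 0 →
      ge V (σ x - x) (V.v x + b (i + 1) * p ^ (n - (m + 1))) ∧
      ∀ z : ℤ, V.v x = z * p ^ (n - (m + 1)) → ¬ (p : ℤ) ∣ z →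
        ex V (σ x - x) (V.v x + b (i + 1) * p ^ (n - (m + 1))) := by
  have hp0 : (0 : ℤ) < p := by exact_mod_cast hp.pos
  have hp1 : (1 : ℤ) < p := by exact_mod_cast hp.one_lt
  have hbpos : 0 < b (i + 1) := (T.stp i hin).spos
  induction m, him using Nat.le_induction with
  | base =>
    have st := T.stp i hin
    intro x hx hx0
    refine st.ram (T.lev i (by omega)) hp hinv hbpos ?_ ?_ hx hx0
    · intro c hc _
      left
      rw [hfix c hc, sub_self]
    · have hδ : σ (βs (i + 1)) - βs (i + 1) ≠ 0 := by
        intro h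
        apply hnf
        have hle : towerField K α (i + 1) ≤ IntermediateField.fixedField (Subgroup.zpowers σ) := by
          rw [st.hE]
          refine sup_le ?_ ?_
          · intro y hy
            rw [IntermediateField.mem_fixedField_iff]
            intro f hf
            have : σ ∈ (towerField K α i).fixingSubgroup := by
              rw [IntermediateField.mem_fixingSubgroup_iff]; exact hfix
            have h2 : Subgroup.zpowers σ ≤ (towerField K α i).fixingSubgroup := by
              rwa [Subgroup.zpowers_le]
            exact (IntermediateField.mem_fixingSubgroup_iff _ _).1 (h2 hf) y hy
          · rw [IntermediateField.adjoin_simple_le_iff, IntermediateField.mem_fixedField_iff]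
            intro f hf
            have h2 : Subgroup.zpowers σ ≤ MulAction.stabilizer (L ≃ₐ[K] L) (βs (i + 1)) := by
              rw [Subgroup.zpowers_le, MulAction.mem_stabilizer_iff]
              exact sub_eq_zero.1 h
            exact MulAction.mem_stabilizer_iff.1 (h2 hf)
        intro y hy
        exact (IntermediateField.mem_fixedField_iff _ _).1 (hle hy) σ
          (Subgroup.mem_zpowers σ)
      have h1 : (σ (βs (i + 1)) - βs (i + 1)) ^ p = σ (βs (i + 1)) - βs (i + 1) := by
        have h2 := hfix _ st.mem
        rw [map_sub, map_pow] at h2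
        rw [← sub_eq_zero, wp_sub hp, h2, sub_self]
      rw [neg_add_cancel]
      refine ⟨hδ, ?_⟩
      have h3 := (ex_self (V := V) hδ).pow p
      rw [h1] at h3
      have h4 := h3.2
      have h5 : ((p : ℤ) - 1) * V.v (σ (βs (i + 1)) - βs (i + 1)) = 0 := by linarith
      rcases mul_eq_zero.1 h5 with h6 | h6
      · omega
      · exact h6
  | succ m him ih =>
    have ih := ih (by omega)
    have st := T.stp (m + 1) hm
    have hpos := st.pos (T.lev (m + 1) (by omega)) hp
    have heps := st.eps
    intro x hx hx0
    refine st.ram (T.lev (m + 1) (by omega)) hp hinv hbpos ?_ ?_ hx hx0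
    · intro c hc hc0
      refine (ih c hc hc0).1.mono ?_
      rw [heps]
      have h7 := mul_pos hbpos hpos
      nlinarith
    · set B := βs (m + 1 + 1)
      have hv := st.exA.2
      have h1 := (ih _ st.mem st.exA.1).2 (-b (m + 1 + 1)) (by rw [hv]; ring)
        (by rw [dvd_neg]; exact st.ndvd)
      rw [hv] at h1
      have h2 : σ (B ^ p - B) - (B ^ p - B) = (σ B - B) ^ p - (σ B - B) := by
        rw [wp_sub hp, map_sub, map_pow]
      rw [h2] at h1
      have hlt := hbm (i + 1) (m + 1 + 1) (by omega) (by omega) hm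
      obtain ⟨q, hq, hex⟩ := ex_artin_schreier p hp
        (t := (b (m + 1 + 1) - b (i + 1)) * p ^ (n - (m + 1)))
        (mul_pos (by omega) (pow_pos hp0 _)) (by convert h1 using 1; ring)
      have : q = -(b (m + 1 + 1) * p ^ (n - (m + 1 + 1))) + b (i + 1) * p ^ (n - (m + 1 + 1)) := by
        apply mul_left_cancel₀ hp0.ne'
        rw [hq, heps]; ring
      rwa [← this]

lemma Tow.ramNum [CharP L p] (T : Tow (K := K) V p n b α βs) (hp : p.Prime)
    (hbm : ∀ i j, 1 ≤ i → i < j → j ≤ n → b i < b j) (hgen : towerField K α n = ⊤)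
    {π : L} (hπ : π ≠ 0 ∧ V.v π = 1)
    {σ : L ≃ₐ[K] L} (hinv : ∀ x : L, V.v (σ x) = V.v x) {i : ℕ}
    (hin : i + 1 ≤ n) (hfix : σ ∈ (towerField K α i).fixingSubgroup)
    (hnf : σ ∉ (towerField K α (i + 1)).fixingSubgroup) : ramNum K V π σ = b (i + 1) := by
  rw [IntermediateField.mem_fixingSubgroup_iff] at hfix hnf
  have h := T.ram hp hbm hinv hin hfix hnf (n - 1) (by omega) (by omega)
  have hbpos : 0 < b (i + 1) := (T.stp i hin).spos
  have e1 : n - 1 + 1 = n := by omega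
  rw [e1, hgen, Nat.sub_self] at h
  simp only [pow_zero, mul_one] at h
  have hin : inInertia K V σ := by
    intro x hx
    by_cases hx0 : x = 0
    · left; simp [hx0]
    have := (h x trivial hx0).1
    rcases hx with hx | hx
    · contradiction
    exact this.mono (by omega)
  have h2 := (h π trivial hπ.1).2 1 hπ.2 (by
    intro h3
    have := Int.eq_one_of_dvd_one (by omega) h3
    have := hp.one_lt
    omega)
  rw [_root_.ramNum, if_pos hin, h2.2, hπ.2]
  ring

end ram

end TR


namespace TR

section gal
variable {K L Ω : Type*} [Field K] [Field L] [Algebra K L] [Field Ω] [Algebra K Ω]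

lemma ext_hom {M E : IntermediateField K L} {x : L} (hx : IsIntegral M x)
    (hE : E = (IntermediateField.adjoin M {x}).restrictScalars K)
    (f : M →ₐ[K] Ω) (y : Ω) (hy : (minpoly M x).eval₂ (f : M →+* Ω) y = 0) :
    ∃ g : E →ₐ[K] Ω, (∀ (w : M) (z : E), (z : L) = w → g z = f w) ∧
      ∀ z : E, (z : L) = x → g z = y := by
  subst hE
  let _ : Algebra M Ω := (f : M →+* Ω).toAlgebra
  have : IsScalarTower K M Ω := IsScalarTower.of_algebraMap_eq' (f.comp_algebraMap).symm
  let pb := IntermediateField.adjoin.powerBasis hx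
  have hy' : Polynomial.aeval y (minpoly M pb.gen) = 0 := by
    rw [IntermediateField.adjoin.powerBasis_gen, IntermediateField.minpoly_gen]
    exact hy
  let g0 : IntermediateField.adjoin M {x} →ₐ[M] Ω := pb.lift y hy'
  let g1 : IntermediateField.adjoin M {x} →ₐ[K] Ω := g0.restrictScalars K
  refine ⟨g1, ?_, ?_⟩
  · intro w z hz
    have : z = (algebraMap M (IntermediateField.adjoin M {x}) w) := Subtype.ext hz
    rw [this]
    exact g0.commutes w
  · intro z hz
    have : z = pb.gen := by
      apply Subtype.ext
      rw [hz, IntermediateField.adjoin.powerBasis_gen, IntermediateField.AdjoinSimple.coe_gen]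
    rw [this]
    exact pb.lift_gen y hy'

lemma finrank_adjoin_step {p m : ℕ} (hp : p.Prime) {M E : IntermediateField K L} {x : L}
    (hE : E = (IntermediateField.adjoin M {x}).restrictScalars K)
    (h1 : Module.finrank K M = p ^ m) (h2 : Module.finrank K E = p ^ (m + 1)) :
    Module.finrank M (IntermediateField.adjoin M {x}) = p := by
  subst hE
  have h3 := Module.finrank_mul_finrank K M (IntermediateField.adjoin M {x})
  have h4 : Module.finrank K (IntermediateField.adjoin M {x}) = p ^ (m + 1) := h2
  rw [h4, h1, pow_succ] at h3
  exact Nat.eq_of_mul_eq_mul_left (pow_pos hp.pos m) h3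

lemma minpoly_step {p m : ℕ} (hp : p.Prime) {M E : IntermediateField K L} {x : L}
    (hE : E = (IntermediateField.adjoin M {x}).restrictScalars K)
    (h1 : Module.finrank K M = p ^ m) (h2 : Module.finrank K E = p ^ (m + 1))
    (c : M) (hc : x ^ p - x = c) :
    IsIntegral M x ∧ minpoly M x = Polynomial.X ^ p - (Polynomial.X + Polynomial.C c) := by
  have hdeg : (Polynomial.X + Polynomial.C c : Polynomial M).degree < (p : ℕ) := by
    rw [Polynomial.degree_X_add_C]
    exact_mod_cast hp.one_lt
  have hmon : (Polynomial.X ^ p - (Polynomial.X + Polynomial.C c) : Polynomial M).Monic :=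
    Polynomial.monic_X_pow_sub hdeg
  have hroot : Polynomial.aeval x
      (Polynomial.X ^ p - (Polynomial.X + Polynomial.C c) : Polynomial M) = 0 := by
    simp only [map_sub, map_pow, Polynomial.aeval_X, map_add, Polynomial.aeval_C]
    have : algebraMap M L c = c := rfl
    rw [this, ← hc]; ring
  have hitg : IsIntegral M x := ⟨_, hmon, hroot⟩
  refine ⟨hitg, ?_⟩
  have h1 := IntermediateField.adjoin.finrank hitg
  rw [finrank_adjoin_step hp hE ‹_› h2] at h1
  have hnd : (Polynomial.X ^ p - (Polynomial.X + Polynomial.C c) : Polynomial M).natDegree = p := by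
    rw [Polynomial.natDegree_sub_eq_left_of_natDegree_lt]
    · simp
    · simp only [Polynomial.natDegree_X_add_C, Polynomial.natDegree_X_pow]
      exact hp.one_lt
  refine (Polynomial.eq_of_monic_of_dvd_of_natDegree_le (minpoly.monic hitg) hmon
    (minpoly.dvd _ _ hroot) ?_).symm
  rw [hnd, ← h1]

/-- Structure map from polynomials to an algebra in characteristic `p`. -/
noncomputable def ιp (p : ℕ) (K L : Type*) [Field K] [Field L] [Algebra K L] [CharP K p] :
    ZMod p →+* L := (algebraMap K L).comp (ZMod.castHom (dvd_refl p) K)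

lemma eval_mem {p m : ℕ} [CharP K p] (α : ℕ → L) (q : MvPolynomial (Fin m) (ZMod p)) :
    MvPolynomial.eval₂ (ιp p K L) (fun k : Fin m => α ((k : ℕ) + 1)) q ∈ towerField K α m := by
  induction q using MvPolynomial.induction_on with
  | C c => rw [MvPolynomial.eval₂_C]; exact (towerField K α m).algebraMap_mem _
  | add f g hf hg => rw [MvPolynomial.eval₂_add]; exact add_mem hf hg
  | mul_X f i hf =>
    rw [MvPolynomial.eval₂_mul, MvPolynomial.eval₂_X]
    exact mul_mem hf (mem_towerField α (by omega) (by omega))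

lemma towerField_succ' (α : ℕ → L) (m : ℕ) : towerField K α (m + 1) =
    (IntermediateField.adjoin (towerField K α m) {α (m + 1)}).restrictScalars K := by
  rw [towerField_succ, ← IntermediateField.restrictScalars_adjoin_eq_sup]

lemma lift_tower {p n : ℕ} (hp : p.Prime) [CharP K p] {α d : ℕ → L} {a : ℕ → K}
    {D : (j : ℕ) → MvPolynomial (Fin (j - 1)) (ZMod p)}
    (hd : ∀ i, d i =
      MvPolynomial.eval₂ (ιp p K L) (fun k : Fin (i - 1) => α ((k : ℕ) + 1)) (D i))
    (hα : ∀ i, 1 ≤ i → i ≤ n → α i ^ p - α i = d i + algebraMap K L (a i))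
    (hfin : ∀ m, m ≤ n → Module.finrank K (towerField K α m) = p ^ m)
    (γ : ℕ → Ω)
    (hγ : ∀ i, 1 ≤ i → i ≤ n → γ i ^ p - γ i =
      MvPolynomial.eval₂ (ιp p K Ω) (fun k : Fin (i - 1) => γ ((k : ℕ) + 1)) (D i)
        + algebraMap K Ω (a i)) (m : ℕ) (hm : m ≤ n) :
    ∃ f : towerField K α m →ₐ[K] Ω, ∀ i, 1 ≤ i → i ≤ m → ∀ z : towerField K α m,
      (z : L) = α i → f z = γ i := by
  induction m with
  | zero =>
    rw [towerField_zero]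
    exact ⟨(Algebra.ofId K Ω).comp (IntermediateField.botEquiv K L).toAlgHom,
      fun i h1 h2 => by omega⟩
  | succ m ih =>
    obtain ⟨f, hf⟩ := ih (by omega)
    have hdm : d (m + 1) ∈ towerField K α m := by
      rw [hd]; exact eval_mem α (D (m + 1))
    let dm : towerField K α m := ⟨_, hdm⟩
    obtain ⟨hitg, hmin⟩ := minpoly_step hp (towerField_succ' α m)
      (hfin m (by omega)) (hfin (m + 1) hm) (dm + algebraMap K _ (a (m + 1)))
      (by rw [hα (m + 1) (by omega) hm]; rfl)
    have hfd : f dm =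
        MvPolynomial.eval₂ (ιp p K Ω) (fun k : Fin m => γ ((k : ℕ) + 1)) (D (m + 1)) := by
      have h0 : dm = MvPolynomial.eval₂ (ιp p K (towerField K α m))
          (fun k : Fin m => (⟨α ((k : ℕ) + 1), mem_towerField α (by omega) (by omega)⟩ :
            towerField K α m)) (D (m + 1)) := by
        apply Subtype.ext
        show d (m + 1) = (towerField K α m).val.toRingHom _
        rw [MvPolynomial.eval₂_comp_left, hd]
        congr 1
      have : f dm = (f : _ →+* Ω) dm := rfl
      rw [this, h0, MvPolynomial.eval₂_comp_left]
      congr 1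
      · exact RingHom.ext_zmod _ _
      · funext k
        exact hf (k + 1) (by omega) (by omega) _ rfl
    obtain ⟨g, hg1, hg2⟩ := ext_hom (E := towerField K α (m + 1)) hitg
      (towerField_succ' α m) f (γ (m + 1)) (by
        rw [hmin]
        simp only [Polynomial.eval₂_sub, Polynomial.eval₂_add, Polynomial.eval₂_X_pow,
          Polynomial.eval₂_X, Polynomial.eval₂_C, map_add]
        have h1 := hγ (m + 1) (by omega) hm
        have h2 : (f : towerField K α m →+* Ω) dm = _ := hfd
        have h3 : (f : towerField K α m →+* Ω) (algebraMap K _ (a (m + 1))) = algebraMap K Ω (a (m + 1)) :=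
          f.commutes _
        rw [h2, h3]
        have h4 : γ (m + 1) ^ p - γ (m + 1) = MvPolynomial.eval₂ (ιp p K Ω)
          (fun k : Fin m => γ ((k : ℕ) + 1)) (D (m + 1)) + algebraMap K Ω (a (m + 1)) := h1
        linear_combination h4)
    refine ⟨g, fun i h1 h2 z hz => ?_⟩
    rcases h2.lt_or_eq with h | h
    · have h' : i ≤ m := by omega
      rw [hg1 ⟨α i, mem_towerField α h1 h'⟩ z hz]
      exact hf i h1 h' _ rfl
    · subst h
      exact hg2 z hz

lemma lift_top {p n : ℕ} (hp : p.Prime) [CharP K p] {α d : ℕ → L} {a : ℕ → K}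
    {D : (j : ℕ) → MvPolynomial (Fin (j - 1)) (ZMod p)}
    (hd : ∀ i, d i =
      MvPolynomial.eval₂ (ιp p K L) (fun k : Fin (i - 1) => α ((k : ℕ) + 1)) (D i))
    (hα : ∀ i, 1 ≤ i → i ≤ n → α i ^ p - α i = d i + algebraMap K L (a i))
    (hfin : ∀ m, m ≤ n → Module.finrank K (towerField K α m) = p ^ m)
    (hgen : towerField K α n = ⊤)
    (γ : ℕ → Ω)
    (hγ : ∀ i, 1 ≤ i → i ≤ n → γ i ^ p - γ i =
      MvPolynomial.eval₂ (ιp p K Ω) (fun k : Fin (i - 1) => γ ((k : ℕ) + 1)) (D i)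
        + algebraMap K Ω (a i)) :
    ∃ f : L →ₐ[K] Ω, ∀ i, 1 ≤ i → i ≤ n → f (α i) = γ i := by
  obtain ⟨f, hf⟩ := lift_tower hp hd hα hfin γ hγ n le_rfl
  refine ⟨f.comp (IntermediateField.inclusion (le_of_eq hgen.symm)
    |>.comp (IntermediateField.topEquiv (F := K) (E := L)).symm.toAlgHom), fun i h1 h2 => ?_⟩
  exact hf i h1 h2 _ rfl

lemma hom_ext_tower {n : ℕ} {α : ℕ → L} (hgen : towerField K α n = ⊤) (f g : L →ₐ[K] Ω)
    (h : ∀ i, 1 ≤ i → i ≤ n → f (α i) = g (α i)) : f = g := by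
  have : f.comp (⊤ : IntermediateField K L).val = g.comp (⊤ : IntermediateField K L).val := by
    apply IntermediateField.algHom_ext_of_eq_adjoin K hgen.symm
    rintro x ⟨i, h1, h2, rfl⟩
    exact h i h1 h2
  ext x
  exact DFunLike.congr_fun this ⟨x, IntermediateField.mem_top⟩

lemma mem_fixing_tower {i : ℕ} {α : ℕ → L} (σ : L ≃ₐ[K] L) :
    σ ∈ (towerField K α i).fixingSubgroup ↔ ∀ j, 1 ≤ j → j ≤ i → σ (α j) = α j := by
  constructor
  · intro h j h1 h2
    exact (IntermediateField.mem_fixingSubgroup_iff _ _).1 h _ (mem_towerField α h1 h2)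
  · intro h
    rw [IntermediateField.mem_fixingSubgroup_iff]
    intro x hx
    have : towerField K α i ≤ AlgHom.fieldRange (IntermediateField.val (IntermediateField.fixedField (Subgroup.zpowers σ))) := by
      rw [IntermediateField.fieldRange_val]
      rw [towerField, IntermediateField.adjoin_le_iff]
      rintro _ ⟨j, h1, h2, rfl⟩
      rintro ⟨τ, hτ⟩
      have : Subgroup.zpowers σ ≤ MulAction.stabilizer (L ≃ₐ[K] L) (α j) := by
        rw [Subgroup.zpowers_le]; exact h j h1 h2
      exact this hτ
    have h2 := this hx
    rw [IntermediateField.fieldRange_val] at h2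
    exact h2 ⟨σ, Subgroup.mem_zpowers σ⟩

end gal
end TR


namespace TR
open MvPolynomial

section grp
variable {K L : Type*} [Field K] [Field L] [Algebra K L]

lemma hom_rename {p m k : ℕ} [CharP K p] (φ : MvPolynomial (Fin m) (ZMod p) →+* L)
    (f : Fin k → Fin m) (q : MvPolynomial (Fin k) (ZMod p)) :
    φ (rename f q) = eval₂ (ιp p K L) (fun j => φ (X (f j))) q := by
  induction q using MvPolynomial.induction_on with
  | C c =>
    rw [rename_C, eval₂_C]
    exact RingHom.congr_fun (RingHom.ext_zmod (φ.comp C) (ιp p K L)) c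
  | add f g hf hg => rw [map_add, map_add, eval₂_add, hf, hg]
  | mul_X f i hf => rw [map_mul, map_mul, eval₂_mul, hf, rename_X, eval₂_X]

lemma hom_eq {p m : ℕ} [CharP K p] (φ : MvPolynomial (Fin m) (ZMod p) →+* L)
    (q : MvPolynomial (Fin m) (ZMod p)) :
    φ q = eval₂ (ιp p K L) (fun j => φ (X j)) q := by
  have := hom_rename (K := K) φ id q
  simpa using this

theorem gal_main (p n : ℕ) (hp : p.Prime) (hn : 1 ≤ n)
    (G : Type*) [Group G] [Finite G] (hG : Nat.card G = p ^ n)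
    (Gser : ℕ → Subgroup G) [∀ j, (Gser j).Normal]
    (hbot : Gser n = ⊥)
    (hcard : ∀ j, j ≤ n → Nat.card (Gser j) = p ^ (n - j))
    (hmono : ∀ i j, i ≤ j → j ≤ n → Gser j ≤ Gser i)
    (D : (j : ℕ) → MvPolynomial (Fin (j - 1)) (ZMod p))
    (hD : IsSaltmanFamily p n G Gser D) [CharP K p]
    {α d : ℕ → L} {a : ℕ → K}
    (hd : ∀ i, d i = eval₂ (ιp p K L) (fun k : Fin (i - 1) => α ((k : ℕ) + 1)) (D i))
    (hα : ∀ i, 1 ≤ i → i ≤ n → α i ^ p - α i = d i + algebraMap K L (a i))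
    (hfin : ∀ m, m ≤ n → Module.finrank K (towerField K α m) = p ^ m)
    (hgen : towerField K α n = ⊤) :
    IsGalois K L ∧ ∃ μ : (L ≃ₐ[K] L) ≃* G, ∀ i, i ≤ n →
      Subgroup.map μ.toMonoidHom (towerField K α i).fixingSubgroup = Gser i := by
  obtain ⟨-, ρ, hρ⟩ := hD
  have hfinL : Module.finrank K L = p ^ n := by
    rw [← hfin n le_rfl, hgen, IntermediateField.finrank_top']
  have hfd : FiniteDimensional K L :=
    Module.finite_of_finrank_pos (by rw [hfinL]; exact pow_pos hp.pos n)
  obtain ⟨-, hfix, hmax, -⟩ := hρ n hn le_rfl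
  let ev : MvPolynomial (Fin n) (ZMod p) →+* L :=
    eval₂Hom (ιp p K L) (fun k : Fin n => α ((k : ℕ) + 1))
  have evX : ∀ k : Fin n, ev (X k) = α (k + 1) := fun k => eval₂_X _ _ _
  -- evaluation of the invariants
  have evXelt : ∀ i (h1 : 1 ≤ i) (h2 : i ≤ n),
      ev (Xelt p D n i (by omega)) = algebraMap K L (a i) := by
    intro i h1 h2
    rw [Xelt, map_sub, map_sub, map_pow, evX, hom_rename (K := K)]
    simp only [evX, Fin.val_castLE]
    have : i - 1 + 1 = i := by omega
    rw [this, ← hd, hα i h1 h2]; ring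
  -- existence of the automorphism
  have hex : ∀ g : G, ∃ f : L →ₐ[K] L, ∀ q, f (ev q) = ev (ρ n (QuotientGroup.mk g) q) := by
    intro g
    let φ : MvPolynomial (Fin n) (ZMod p) →+* L :=
      ev.comp ((ρ n (QuotientGroup.mk g) : _ ≃+* _) : _ →+* _)
    let γ : ℕ → L := fun i => if h : i - 1 < n then φ (X ⟨i - 1, h⟩) else 0
    have hγ' : ∀ k : Fin n, φ (X k) = γ (k + 1) := by
      intro k
      have : (k : ℕ) + 1 - 1 < n := by simp
      simp only [γ, this, dite_true]
      rfl
    have hγ : ∀ i, 1 ≤ i → i ≤ n → γ i ^ p - γ i =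
        eval₂ (ιp p K L) (fun k : Fin (i - 1) => γ ((k : ℕ) + 1)) (D i) + algebraMap K L (a i) := by
      intro i h1 h2
      have h3 : φ (Xelt p D n i (by omega)) = algebraMap K L (a i) := by
        rw [← evXelt i h1 h2]
        show ev (ρ n (QuotientGroup.mk g) _) = _
        rw [(hfix _).2 (Algebra.subset_adjoin ⟨i, h1, h2, rfl⟩)]
      rw [Xelt, map_sub, map_sub, map_pow, hγ', hom_rename (K := K)] at h3
      simp only [hγ', Fin.val_castLE] at h3
      have : i - 1 + 1 = i := by omega
      rw [this] at h3
      rw [← h3]; ring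
    obtain ⟨f, hf⟩ := lift_top hp hd hα hfin hgen γ hγ
    refine ⟨f, fun q => ?_⟩
    have h1 := hom_eq (K := K) ((f : L →+* L).comp ev) q
    have h2 := hom_eq (K := K) φ q
    have h3 : (fun j => ((f : L →+* L).comp ev) (X j)) = fun j => φ (X j) := by
      funext j
      rw [hγ']
      show f (ev (X j)) = _
      rw [evX]
      exact hf _ (by omega) (by omega)
    rw [h3, ← h2] at h1
    exact h1
  choose Φ hΦ using hex
  have Φext : ∀ f g : L →ₐ[K] L, (∀ q, f (ev q) = g (ev q)) → f = g := by
    intro f g h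
    apply hom_ext_tower hgen
    intro i h1 h2
    have := h (X ⟨i - 1, by omega⟩)
    rw [evX] at this
    simpa [Nat.sub_add_cancel h1] using this
  have Φone : Φ 1 = 1 := by
    apply Φext
    intro q
    rw [hΦ, QuotientGroup.mk_one, map_one]; rfl
  have Φmul : ∀ g h, Φ (g * h) = Φ g * Φ h := by
    intro g h
    apply Φext
    intro q
    rw [hΦ, QuotientGroup.mk_mul, map_mul, AlgHom.mul_apply, hΦ, hΦ]
    rfl
  let Φm : G →* (L →ₐ[K] L) := ⟨⟨Φ, Φone⟩, Φmul⟩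
  let Ψ : G →* (L ≃ₐ[K] L) := (algEquivEquivAlgHom K L).symm.toMonoidHom.comp Φm
  have hΨ : ∀ g x, Ψ g x = Φ g x := by
    intro g x
    have : (algEquivEquivAlgHom K L) (Ψ g) = Φ g := by
      show (algEquivEquivAlgHom K L) ((algEquivEquivAlgHom K L).symm (Φ g)) = Φ g
      exact MulEquiv.apply_symm_apply _ _
    rw [← this]; rfl
  have hinj : Function.Injective Ψ := by
    rw [injective_iff_map_eq_one]
    intro g hg
    by_contra hg1
    have hne : (QuotientGroup.mk g : G ⧸ Gser n) ≠ 1 := by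
      intro h
      rw [QuotientGroup.eq_one_iff, hbot, Subgroup.mem_bot] at h
      exact hg1 h
    obtain ⟨M, hM, hker⟩ := Ideal.exists_le_maximal (RingHom.ker ev) (RingHom.ker_ne_top ev)
    obtain ⟨s, hs⟩ := hmax M hM _ hne
    apply hs
    apply hker
    rw [RingHom.mem_ker, map_sub, ← hΦ, ← hΨ, hg]
    simp
  have hcardAut : Nat.card (L ≃ₐ[K] L) = p ^ n := by
    apply le_antisymm
    · rw [← hfinL, Nat.card_eq_fintype_card]
      exact AlgEquiv.card_le
    · rw [← hG]
      exact Nat.card_le_card_of_injective Ψ hinj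
  have hgal : IsGalois K L := IsGalois.of_card_aut_eq_finrank K L (by rw [hcardAut, hfinL])
  have hbij : Function.Bijective Ψ :=
    (Nat.bijective_iff_injective_and_card Ψ).2 ⟨hinj, by rw [hG, hcardAut]⟩
  have compat : ∀ (g : G) (i m : ℕ) (him : i ≤ m) (hmn : m ≤ n)
      (q : MvPolynomial (Fin i) (ZMod p)),
      ρ m (QuotientGroup.mk g) (rename (Fin.castLE him) q) =
        rename (Fin.castLE him) (ρ i (QuotientGroup.mk g) q) := by
    intro g i m him
    induction m, him using Nat.le_induction with
    | base =>
      intro _ q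
      have : (Fin.castLE (le_refl i)) = id := by ext; rfl
      simp [this]
    | succ m him ih =>
      intro hmn q
      have h1 := (hρ (m + 1) (by omega) hmn).2.2.2 g (rename (Fin.castLE him) q)
      have h2 := ih (by omega) q
      have h3 := h1.trans (congrArg _ h2)
      erw [rename_rename, rename_rename] at h3
      exact h3
  have hle : ∀ i, i ≤ n → Subgroup.map Ψ (Gser i) ≤ (towerField K α i).fixingSubgroup := by
    rintro i hi _ ⟨g, hg, rfl⟩
    rw [mem_fixing_tower]
    intro j h1 h2
    have hg' : (QuotientGroup.mk g : G ⧸ Gser j) = 1 := by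
      rw [QuotientGroup.eq_one_iff]
      exact hmono j i h2 hi hg
    have h3 := compat g j n (by omega) le_rfl (X ⟨j - 1, by omega⟩)
    rw [hg', map_one] at h3
    have h4 := hΦ g (X ⟨j - 1, by omega⟩)
    rw [rename_X] at h3
    have h5 : ρ n (QuotientGroup.mk g) (X ⟨j - 1, by omega⟩) = X ⟨j - 1, by omega⟩ := by
      simpa using h3
    rw [h5, evX] at h4
    rw [hΨ]
    simpa [Nat.sub_add_cancel h1] using h4
  have heq : ∀ i, i ≤ n → Subgroup.map Ψ (Gser i) = (towerField K α i).fixingSubgroup := by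
    intro i hi
    apply Subgroup.eq_of_le_of_card_ge (hle i hi)
    rw [IsGalois.card_fixingSubgroup_eq_finrank, Subgroup.card_map_of_injective hinj, hcard i hi]
    have h1 := Module.finrank_mul_finrank K (towerField K α i) L
    have h2 : p ^ n = p ^ i * p ^ (n - i) := by rw [← pow_add, Nat.add_sub_cancel' hi]
    rw [hfin i hi, hfinL, h2] at h1
    exact (Nat.eq_of_mul_eq_mul_left (pow_pos hp.pos i) h1).le
  refine ⟨hgal, (MulEquiv.ofBijective Ψ hbij).symm, fun i hi => ?_⟩
  rw [← heq i hi]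
  ext g
  constructor
  · rintro ⟨_, ⟨g', hg', rfl⟩, rfl⟩
    have : (MulEquiv.ofBijective Ψ hbij).symm (Ψ g') = g' :=
      (MulEquiv.ofBijective Ψ hbij).symm_apply_apply g'
    show (MulEquiv.ofBijective Ψ hbij).symm (Ψ g') ∈ _
    rw [this]; exact hg'
  · intro hg
    exact ⟨Ψ g, ⟨g, hg, rfl⟩, (MulEquiv.ofBijective Ψ hbij).symm_apply_apply g⟩

end grp
end TR


namespace TR

section rp
variable {K L : Type*} [Field K] [Field L] [Algebra K L]

structure Ram (V : DVal L) (π : L) (p n : ℕ) (b : ℕ → ℤ)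
    (F : ℕ → Subgroup (L ≃ₐ[K] L)) : Prop where
  hF0 : F 0 = ⊤
  hFn : F n = ⊥
  anti : ∀ i j, i ≤ j → F j ≤ F i
  card : ∀ i, i ≤ n → Nat.card (F i) = p ^ (n - i)
  bmono : ∀ i j, 1 ≤ i → i < j → j ≤ n → b i < b j
  bpos : ∀ i, 1 ≤ i → i ≤ n → 0 < b i
  hR : ∀ (i : ℕ) (σ : L ≃ₐ[K] L), i + 1 ≤ n → σ ∈ F i → σ ∉ F (i + 1) → ramNum K V π σ = b (i + 1)

variable {V : DVal L} {π : L} {p n : ℕ} {b u : ℕ → ℤ} {F : ℕ → Subgroup (L ≃ₐ[K] L)}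

lemma Ram.layer (R : Ram V π p n b F) {σ : L ≃ₐ[K] L} (hσ : σ ≠ 1) :
    ∃ i, i + 1 ≤ n ∧ σ ∈ F i ∧ σ ∉ F (i + 1) := by
  by_contra! h
  have : ∀ i, i ≤ n → σ ∈ F i := by
    intro i
    induction i with
    | zero => intro _; rw [R.hF0]; trivial
    | succ i ih => intro hi; exact h i hi (ih (by omega))
  have h2 := this n le_rfl
  rw [R.hFn, Subgroup.mem_bot] at h2
  exact hσ h2

lemma Ram.ble (R : Ram V π p n b F) {i j : ℕ} (h1 : 1 ≤ i) (h : i ≤ j) (hj : j ≤ n) :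
    (b i : ℝ) ≤ b j := by
  rcases h.lt_or_eq with h | rfl
  · exact_mod_cast (R.bmono i j h1 h hj).le
  · exact le_rfl

lemma Ram.lower_eq (R : Ram V π p n b F) {i : ℕ} {t : ℝ} (hi : i ≤ n)
    (h1 : 1 ≤ i → (b i : ℝ) < t) (h2 : i + 1 ≤ n → t ≤ b (i + 1)) :
    lowerSet K V π t = (F i : Set (L ≃ₐ[K] L)) := by
  ext σ
  simp only [lowerSet, Set.mem_ofPred_eq, SetLike.mem_coe]
  by_cases hσ : σ = 1
  · subst hσ; simp [one_mem]
  obtain ⟨j, hj, hj1, hj2⟩ := R.layer hσ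
  rw [R.hR j σ hj hj1 hj2]
  simp only [hσ, false_or]
  constructor
  · intro ht
    by_contra hni
    have hji : j < i := by
      by_contra hc
      exact hni (R.anti i j (by omega) hj1)
    have := R.ble (i := j + 1) (j := i) (by omega) (by omega) hi
    linarith [h1 (by omega)]
  · intro hm
    have hij : i ≤ j := by
      by_contra hc
      exact hj2 (R.anti (j + 1) i (by omega) hm)
    have := R.ble (i := i + 1) (j := j + 1) (by omega) (by omega) hj
    linarith [h2 (by omega)]

lemma Ram.exists_lower (R : Ram V π p n b F) (t : ℝ) :
    ∃ i, i ≤ n ∧ lowerSet K V π t = (F i : Set (L ≃ₐ[K] L)) := by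
  by_contra! h
  have key : ∀ i, i ≤ n → (1 ≤ i → (b i : ℝ) < t) := by
    intro i
    induction i with
    | zero => intro _ h; omega
    | succ i ih =>
      intro hi _
      by_contra hc
      exact h i (by omega) (R.lower_eq (by omega) (ih (by omega)) (fun _ => not_lt.1 hc))
  exact h n le_rfl (R.lower_eq le_rfl (key n le_rfl) (fun h => by omega))

lemma Ram.exists_lower' (R : Ram V π p n b F) (i : ℕ) (hi : i ≤ n) :
    ∃ t : ℝ, (F i : Set (L ≃ₐ[K] L)) = lowerSet K V π t := by
  by_cases h : i + 1 ≤ n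
  · refine ⟨b (i + 1), (R.lower_eq hi (fun h1 => ?_) (fun _ => le_rfl)).symm⟩
    exact_mod_cast R.bmono i (i + 1) h1 (by omega) h
  · refine ⟨b i + 1, (R.lower_eq hi (fun h1 => ?_) (fun h' => absurd h' h)).symm⟩
    linarith

lemma Ram.isLower (R : Ram V π p n b F) (hp : p.Prime) (x : ℝ) :
    IsLowerBreak K V π x ↔ ∃ i, 1 ≤ i ∧ i ≤ n ∧ x = ((b i : ℤ) : ℝ) := by
  constructor
  · rintro ⟨σ, hσ, rfl⟩
    obtain ⟨j, hj, hj1, hj2⟩ := R.layer hσ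
    exact ⟨j + 1, by omega, hj, by rw [R.hR j σ hj hj1 hj2]⟩
  · rintro ⟨i, h1, h2, rfl⟩
    obtain ⟨j, rfl⟩ : ∃ j, i = j + 1 := ⟨i - 1, by omega⟩
    have : ∃ σ, σ ∈ F j ∧ σ ∉ F (j + 1) := by
      by_contra! hc
      have he : F j = F (j + 1) := le_antisymm hc (R.anti j (j + 1) (by omega))
      have h3 := R.card j (by omega)
      rw [he, R.card (j + 1) h2] at h3
      have := Nat.pow_right_injective hp.two_le h3
      omega
    obtain ⟨σ, hσ1, hσ2⟩ := this
    refine ⟨σ, ?_, by rw [R.hR j σ h2 hσ1 hσ2]⟩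
    rintro rfl
    exact hσ2 (one_mem _)

lemma Ram.herb (R : Ram V π p n b F) (hp : p.Prime) (hn : 1 ≤ n)
    (hb1 : b 1 = u 1)
    (hbrec : ∀ i, 1 ≤ i → i + 1 ≤ n → b (i + 1) = b i + (p : ℤ) ^ i * (u (i + 1) - u i))
    (i : ℕ) (h1 : 1 ≤ i) (h2 : i ≤ n) : hherb K V π (b i) = u i := by
  set f : ℝ → ℝ := fun t =>
    (Nat.card ↥(lowerSet K V π t) : ℝ) / (Nat.card ↥(lowerSet K V π 0) : ℝ) with hf
  have hp0 : (0 : ℝ) < p := by exact_mod_cast hp.pos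
  have h0 : (Nat.card ↥(lowerSet K V π 0) : ℝ) = p ^ n := by
    rw [R.lower_eq (i := 0) (t := 0) (by omega) (fun h => by omega)
      (fun h => by exact_mod_cast (R.bpos 1 le_rfl hn).le)]
    have := R.card 0 (by omega)
    simp only [SetLike.coe_sort_coe]
    rw [this]; simp
  have hval : ∀ j, j ≤ n → ∀ t : ℝ, (1 ≤ j → (b j : ℝ) < t) → (j + 1 ≤ n → t ≤ b (j + 1)) →
      f t = ((p : ℝ) ^ j)⁻¹ := by
    intro j hj t ht1 ht2
    simp only [hf]
    rw [h0, R.lower_eq hj ht1 ht2]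
    simp only [SetLike.coe_sort_coe]
    rw [R.card j hj]
    have : (p : ℝ) ^ n = p ^ j * p ^ (n - j) := by rw [← pow_add, Nat.add_sub_cancel' hj]
    rw [this]; push_cast
    field_simp
  have hitg : ∀ j, j + 1 ≤ n → ∀ x y : ℝ, x ≤ y → (1 ≤ j → (b j : ℝ) ≤ x) → y ≤ b (j + 1) →
      IntervalIntegrable f MeasureTheory.volume x y ∧
      ∫ t in x..y, f t = (y - x) * ((p : ℝ) ^ j)⁻¹ := by
    intro j hj x y hxy hx hy
    have hc : ∀ t ∈ Set.uIoc x y, f t = ((p : ℝ) ^ j)⁻¹ := by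
      intro t ht
      rw [Set.uIoc_of_le hxy] at ht
      exact hval j (by omega) t (fun h => (hx h).trans_lt ht.1) (fun _ => ht.2.trans hy)
    constructor
    · exact (intervalIntegrable_const (c := ((p : ℝ) ^ j)⁻¹)).congr (fun t ht => (hc t ht).symm)
    · rw [intervalIntegral.integral_congr_ae (g := fun _ => ((p : ℝ) ^ j)⁻¹)
        (Filter.Eventually.of_forall hc)]
      simp
  have main : ∀ j, j + 1 ≤ n → IntervalIntegrable f MeasureTheory.volume 0 (b (j + 1)) ∧
      ∫ t in (0:ℝ)..(b (j + 1)), f t = u (j + 1) := by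
    intro j
    induction j with
    | zero =>
      intro hj
      have := hitg 0 hj 0 (b (0 + 1)) (by exact_mod_cast (R.bpos 1 le_rfl hn).le)
        (fun h => by omega) le_rfl
      refine ⟨this.1, this.2.trans ?_⟩
      simp [hb1]
    | succ j ih =>
      intro hj
      obtain ⟨ih1, ih2⟩ := ih (by omega)
      have hle : (b (j + 1) : ℝ) ≤ b (j + 1 + 1) := R.ble (by omega) (by omega) hj
      obtain ⟨h3, h4⟩ := hitg (j + 1) hj (b (j + 1)) (b (j + 1 + 1)) hle (fun _ => le_rfl) le_rfl
      refine ⟨ih1.trans h3, ?_⟩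
      rw [← intervalIntegral.integral_add_adjacent_intervals ih1 h3, ih2, h4,
        hbrec (j + 1) (by omega) hj]
      push_cast
      field_simp
      ring
  obtain ⟨j, rfl⟩ : ∃ j, i = j + 1 := ⟨i - 1, by omega⟩
  exact (main j h2).2

lemma Ram.isUpper (R : Ram V π p n b F) (hp : p.Prime) (hn : 1 ≤ n)
    (hb1 : b 1 = u 1)
    (hbrec : ∀ i, 1 ≤ i → i + 1 ≤ n → b (i + 1) = b i + (p : ℤ) ^ i * (u (i + 1) - u i)) (x : ℝ) :
    IsUpperBreak K V π x ↔ ∃ i, 1 ≤ i ∧ i ≤ n ∧ x = ((u i : ℤ) : ℝ) := by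
  constructor
  · rintro ⟨y, hy, rfl⟩
    obtain ⟨i, h1, h2, rfl⟩ := (R.isLower hp y).1 hy
    exact ⟨i, h1, h2, R.herb hp hn hb1 hbrec i h1 h2⟩
  · rintro ⟨i, h1, h2, rfl⟩
    exact ⟨b i, (R.isLower hp _).2 ⟨i, h1, h2, rfl⟩, R.herb hp hn hb1 hbrec i h1 h2⟩

end rp
end TR

open MvPolynomial in
theorem tower_ramification (p n : ℕ) (hp : p.Prime) (hn : 1 ≤ n)
    (G : Type*) [Group G] [Finite G] (hG : Nat.card G = p ^ n)
    (Gser : ℕ → Subgroup G) [∀ j, (Gser j).Normal]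
    (htop : Gser 0 = ⊤) (hbot : Gser n = ⊥)
    (hlt : ∀ j, j < n → Gser (j + 1) < Gser j)
    (hcard : ∀ j, j ≤ n → Nat.card (Gser j) = p ^ (n - j))
    (D : (j : ℕ) → MvPolynomial (Fin (j - 1)) (ZMod p))
    (hD : IsSaltmanFamily p n G Gser D)
    -- K: a local field of characteristic p with perfect residue field
    (K : Type*) [Field K] [CharP K p]
    (vK : DVal K) (hcomplete : vK.IsComplete) (hperf : vK.PerfectResidue p)
    -- the data u_i, a_i, b_i
    (u b : ℕ → ℤ)
    (hu_pos : ∀ i, 1 ≤ i → i ≤ n → 0 < u i)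
    (hu_mono : ∀ i, 1 ≤ i → i + 1 ≤ n → u i < u (i + 1))
    (hu_ndvd : ∀ i, 1 ≤ i → i ≤ n → ¬ (p : ℤ) ∣ u i)
    (hb1 : b 1 = u 1)
    (hbrec : ∀ i, 1 ≤ i → i + 1 ≤ n → b (i + 1) = b i + (p : ℤ) ^ i * (u (i + 1) - u i))
    (a : ℕ → K) (ha : ∀ i, 1 ≤ i → i ≤ n → a i ≠ 0 ∧ vK.v (a i) = -u i)
    -- the tower K_i = K_{i-1}(α_i) inside L = K_n
    (L : Type*) [Field L] [Algebra K L]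
    (α : ℕ → L) (d : ℕ → L)
    (hd : ∀ i, d i =
      eval₂ ((algebraMap K L).comp (ZMod.castHom (dvd_refl p) K))
        (fun k : Fin (i - 1) => α ((k : ℕ) + 1)) (D i))
    (hα : ∀ i, 1 ≤ i → i ≤ n → α i ^ p - α i = d i + algebraMap K L (a i))
    (hgen : towerField K α n = ⊤)
    -- vL: the normalized valuation of L, with ramification index e over K
    (vL : DVal L) (e : ℕ) (hepos : 0 < e)
    (he : ∀ x : K, x ≠ 0 → vL.v (algebraMap K L x) = e * vK.v x)
    (hinv : ∀ σ : L ≃ₐ[K] L, ∀ x : L, vL.v (σ x) = vL.v x)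
    (πL : L) (hπL : πL ≠ 0 ∧ vL.v πL = 1)
    -- main hypothesis: b_i > −p^{i-1} v_K(d_i) for all i ∉ Σ_G
    (hmain : ∀ i, 1 ≤ i → i ≤ n → ¬ splitAt Gser i →
      d i = 0 ∨ -(p : ℚ) ^ (i - 1) * ((vL.v (d i) : ℚ) / (e : ℚ)) < (b i : ℚ)) :
    -- (a) K_n/K is Galois with group G, compatibly with the filtration
    (IsGalois K L ∧
      ∃ μ : (L ≃ₐ[K] L) ≃* G,
        ∀ i, i ≤ n →
          Subgroup.map μ.toMonoidHom (towerField K α i).fixingSubgroup = Gser i) ∧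
    -- (b) K_n/K is totally ramified, with the prescribed ramification breaks,
    --     and v_K(α_i) = −u_i/p
    ((e : ℤ) = (p : ℤ) ^ n ∧
      (∀ x : ℝ, IsUpperBreak K vL πL x ↔ ∃ i, 1 ≤ i ∧ i ≤ n ∧ x = ((u i : ℤ) : ℝ)) ∧
      (∀ x : ℝ, IsLowerBreak K vL πL x ↔ ∃ i, 1 ≤ i ∧ i ≤ n ∧ x = ((b i : ℤ) : ℝ)) ∧
      (∀ i, 1 ≤ i → i ≤ n → vL.v (α i) = -(p : ℤ) ^ (n - 1) * u i)) ∧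
    -- (c) the ramification subgroups are exactly the Gal(K_n/K_i), 0 ≤ i ≤ n
    ((∀ t : ℝ, ∃ i, i ≤ n ∧
        lowerSet K vL πL t = ((towerField K α i).fixingSubgroup : Set (L ≃ₐ[K] L))) ∧
      (∀ i, i ≤ n → ∃ t : ℝ,
        ((towerField K α i).fixingSubgroup : Set (L ≃ₐ[K] L)) = lowerSet K vL πL t)) := by
  have hp0 : (0 : ℤ) < p := by exact_mod_cast hp.pos
  have hCL : CharP L p := charP_of_injective_algebraMap (algebraMap K L).injective p
  have he0 : (0 : ℤ) < e := by exact_mod_cast hepos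
  have hexa : ∀ i, 1 ≤ i → i ≤ n → TR.ex vL (algebraMap K L (a i)) (-(u i * (e : ℤ))) := by
    intro i h1 h2
    obtain ⟨h3, h4⟩ := ha i h1 h2
    refine ⟨by simpa using h3, ?_⟩
    rw [he _ h3, h4]; ring
  have hdmem : ∀ m, m + 1 ≤ n → d (m + 1) ∈ towerField K α m := by
    intro m _
    rw [hd]
    exact TR.eval_mem α (D (m + 1))
  have hdge : ∀ m, m + 1 ≤ n →
      d (m + 1) = 0 ∨ -(b (m + 1) * (e : ℤ)) < (p : ℤ) ^ m * vL.v (d (m + 1)) := by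
    intro m hm
    by_cases hs : splitAt Gser (m + 1)
    · left
      rw [hd, (hD.1 (m + 1) (by omega) hm).1 hs, eval₂_zero]
    · rcases hmain (m + 1) (by omega) hm hs with h | h
      · exact Or.inl h
      · right
        have he' : (0 : ℚ) < e := by exact_mod_cast hepos
        rw [Nat.add_sub_cancel, ← mul_div_assoc, div_lt_iff₀ he'] at h
        have h' : -((b (m + 1) : ℚ) * (e : ℚ)) < (p : ℚ) ^ m * (vL.v (d (m + 1)) : ℚ) := by
          linarith
        exact_mod_cast h'
  obtain ⟨hbmono, hbpos⟩ := TR.b_pos_mono hp hu_pos hu_mono hb1 hbrec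
  obtain ⟨hen, β, T⟩ := TR.exists_tow hp hu_pos hu_mono hu_ndvd hb1 hbrec
    (TR.lev_bot vK hperf vL e hepos he) hexa hdmem hdge hα hgen
  have hGmono : ∀ i j, i ≤ j → j ≤ n → Gser j ≤ Gser i := by
    intro i j hij
    induction j, hij using Nat.le_induction with
    | base => intro _; exact le_rfl
    | succ j hij ih => intro hj; exact (hlt j (by omega)).le.trans (ih (by omega))
  have hgal := TR.gal_main p n hp hn G hG Gser hbot hcard hGmono D hD hd hα T.fin hgen
  obtain ⟨hIG, μ, hμ⟩ := hgal
  have R : TR.Ram vL πL p n b (fun i => (towerField K α i).fixingSubgroup) := by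
    refine ⟨?_, ?_, ?_, ?_, hbmono, hbpos, ?_⟩
    · simp only [TR.towerField_zero]
      exact IntermediateField.fixingSubgroup_bot
    · simp only [hgen]
      exact IntermediateField.fixingSubgroup_top
    · intro i j hij
      exact IntermediateField.fixingSubgroup_le (TR.towerField_mono α hij)
    · intro i hi
      rw [← hcard i hi, ← hμ i hi]
      exact (Subgroup.card_map_of_injective μ.injective).symm
    · intro i σ hi h1 h2
      exact T.ramNum hp hbmono hgen hπL (hinv σ) hi h1 h2
  have hbu : ∀ m, m + 1 ≤ n → b (m + 1) ≤ (p : ℤ) ^ m * u (m + 1) := by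
    intro m
    induction m with
    | zero => intro _; simp [hb1]
    | succ m ih =>
      intro hm
      rw [hbrec (m + 1) (by omega) hm]
      have h1 := ih (by omega)
      have h2 := hu_pos (m + 1) (by omega) (by omega)
      have h3 : (p : ℤ) ^ m * u (m + 1) ≤ (p : ℤ) ^ (m + 1) * u (m + 1) := by
        apply mul_le_mul_of_nonneg_right _ h2.le
        exact pow_le_pow_right₀ (by omega) (by omega)
      linarith
  have hvα : ∀ i, 1 ≤ i → i ≤ n → vL.v (α i) = -(p : ℤ) ^ (n - 1) * u i := by
    intro i h1 h2
    obtain ⟨m, rfl⟩ : ∃ m, i = m + 1 := ⟨i - 1, by omega⟩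
    have hex : TR.ex vL (α (m + 1) ^ p - α (m + 1)) (-(u (m + 1) * (e : ℤ))) := by
      rw [hα _ h1 h2, add_comm]
      apply (hexa _ h1 h2).add_ge
      rcases hdge m h2 with h | h
      · exact Or.inl h
      · right
        have h3 := mul_le_mul_of_nonneg_right (hbu m h2) he0.le
        have h4 : (p : ℤ) ^ m * (-(u (m + 1) * e)) < (p : ℤ) ^ m * vL.v (d (m + 1)) := by
          linarith
        have := lt_of_mul_lt_mul_left h4 (pow_pos hp0 m).le
        omega
    obtain ⟨q, hq, hq2⟩ := TR.ex_artin_schreier p hp (mul_pos (hu_pos _ h1 h2) he0) hex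
    rw [hq2.2]
    have h5 : (p : ℤ) ^ n = p * p ^ (n - 1) := by
      rw [← pow_succ']; congr 1; omega
    rw [hen, h5] at hq
    apply mul_left_cancel₀ hp0.ne'
    rw [hq]; ring
  exact ⟨⟨hIG, μ, hμ⟩, ⟨hen, R.isUpper hp hn hb1 hbrec, R.isLower hp, hvα⟩,
    R.exists_lower, R.exists_lower'⟩
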